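/- arXiv:0812.3431 — 6 statements merged into one kernel-verified Lean document; each statement's English description precedes it below -/
import Mathlib

section
/- An R-module is Gorenstein projective if and only if it is a direct summand of a strongly Gorenstein projective R-module. -/
universe u

open LinearMap DirectSum

section Defs

variable (R : Type u) [CommRing R]

/-- `Ext¹_R(M, Q) = 0`, expressed by the splitting of all extensions of `M` by `Q`. -/
def Ext1Zero (M Q : Type u) [AddCommGroup M] [Module R M] [AddCommGroup Q] [Module R Q] :
    Prop :=
  ∀ (E : ModuleCat.{u} R) (i : Q →ₗ[R] E) (p : E →ₗ[R] M),
    Function.Injective i → Function.Surjective p → LinearMap.range i = LinearMap.ker p →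
      ∃ s : M →ₗ[R] E, p ∘ₗ s = LinearMap.id

/-- `Tor₁^R(M, N) = 0`, expressed via flat presentations of `N`:
for every surjection `p : F ↠ N` with `F` flat, `ker p ⊗ M → F ⊗ M` is injective. -/
def Tor1Zero (M N : Type u) [AddCommGroup M] [Module R M] [AddCommGroup N] [Module R N] :
    Prop :=
  ∀ (F : ModuleCat.{u} R), Module.Flat R F →
    ∀ p : F →ₗ[R] N, Function.Surjective p →
      Function.Injective (LinearMap.rTensor M (LinearMap.ker p).subtype)

/-- `M` is strongly Gorenstein projective: there is an exact complex
`⋯ → P → P → P → ⋯` with a single projective `P` and single differential `f`,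
which stays exact under `Hom(-, Q)` for every projective `Q`, and `M ≅ Im f`. -/
def IsSGProjective (M : Type u) [AddCommGroup M] [Module R M] : Prop :=
  ∃ P : ModuleCat.{u} R, Module.Projective R P ∧
    ∃ f : P →ₗ[R] P, f ∘ₗ f = 0 ∧ LinearMap.ker f = LinearMap.range f ∧
      Nonempty (M ≃ₗ[R] LinearMap.range f) ∧
      ∀ Q : ModuleCat.{u} R, Module.Projective R Q →
        ∀ g : P →ₗ[R] Q, g ∘ₗ f = 0 → ∃ h : P →ₗ[R] Q, g = h ∘ₗ f

/-- `M` is strongly Gorenstein flat: there is an exact complex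
`⋯ → F → F → F → ⋯` with a single flat `F` and single differential `f`,
which stays exact under `- ⊗ I` for every injective `I`, and `M ≅ Im f`. -/
def IsSGFlat (M : Type u) [AddCommGroup M] [Module R M] : Prop :=
  ∃ F : ModuleCat.{u} R, Module.Flat R F ∧
    ∃ f : F →ₗ[R] F, f ∘ₗ f = 0 ∧ LinearMap.ker f = LinearMap.range f ∧
      Nonempty (M ≃ₗ[R] LinearMap.range f) ∧
      ∀ I : ModuleCat.{u} R, Module.Injective R I →
        LinearMap.ker (LinearMap.rTensor I f) = LinearMap.range (LinearMap.rTensor I f)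

/-- `M` is Gorenstein projective: it is a syzygy of a totally acyclic complex of
projective modules. -/
def IsGProjective (M : Type u) [AddCommGroup M] [Module R M] : Prop :=
  ∃ (P : ℤ → ModuleCat.{u} R) (d : ∀ i : ℤ, P (i + 1) →ₗ[R] P i),
    (∀ i, Module.Projective R (P i)) ∧
    (∀ i, d i ∘ₗ d (i + 1) = 0) ∧
    (∀ i, LinearMap.ker (d i) = LinearMap.range (d (i + 1))) ∧
    Nonempty (M ≃ₗ[R] LinearMap.range (d 0)) ∧
    ∀ Q : ModuleCat.{u} R, Module.Projective R Q →
      ∀ (i : ℤ) (g : P (i + 1) →ₗ[R] Q), g ∘ₗ d (i + 1) = 0 →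
        ∃ h : P i →ₗ[R] Q, g = h ∘ₗ d i

/-- `M` is Gorenstein flat: it is a syzygy of an exact complex of flat modules
which stays exact under `- ⊗ I` for every injective `I`. -/
def IsGFlat (M : Type u) [AddCommGroup M] [Module R M] : Prop :=
  ∃ (F : ℤ → ModuleCat.{u} R) (d : ∀ i : ℤ, F (i + 1) →ₗ[R] F i),
    (∀ i, Module.Flat R (F i)) ∧
    (∀ i, d i ∘ₗ d (i + 1) = 0) ∧
    (∀ i, LinearMap.ker (d i) = LinearMap.range (d (i + 1))) ∧
    Nonempty (M ≃ₗ[R] LinearMap.range (d 0)) ∧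
    ∀ I : ModuleCat.{u} R, Module.Injective R I →
      ∀ i : ℤ, LinearMap.ker (LinearMap.rTensor I (d i)) =
        LinearMap.range (LinearMap.rTensor I (d (i + 1)))

/-- A class of `R`-modules is projectively resolving if it contains the projectives and,
in every short exact sequence `0 → A → B → C → 0` with `C` in the class, `A` is in the
class iff `B` is. -/
def ProjResolving (X : ModuleCat.{u} R → Prop) : Prop :=
  (∀ P : ModuleCat.{u} R, Module.Projective R P → X P) ∧
  ∀ (A B C : ModuleCat.{u} R) (i : A →ₗ[R] B) (p : B →ₗ[R] C),
    Function.Injective i → Function.Surjective p → LinearMap.range i = LinearMap.ker p →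
      X C → (X A ↔ X B)

/-- Gorenstein projective dimension at most `n`. -/
def GpdLE : ℕ → ModuleCat.{u} R → Prop
  | 0, M => IsGProjective R M
  | n + 1, M => ∃ (G : ModuleCat.{u} R) (p : G →ₗ[R] M),
      IsGProjective R G ∧ Function.Surjective p ∧ GpdLE n (ModuleCat.of R (LinearMap.ker p))

/-- Gorenstein flat dimension at most `n`. -/
def GfdLE : ℕ → ModuleCat.{u} R → Prop
  | 0, M => IsGFlat R M
  | n + 1, M => ∃ (G : ModuleCat.{u} R) (p : G →ₗ[R] M),
      IsGFlat R G ∧ Function.Surjective p ∧ GfdLE n (ModuleCat.of R (LinearMap.ker p))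

/-- Flat dimension at most `n`. -/
def FlatDimLE : ℕ → ModuleCat.{u} R → Prop
  | 0, M => Module.Flat R M
  | n + 1, M => ∃ (G : ModuleCat.{u} R) (p : G →ₗ[R] M),
      Module.Flat R G ∧ Function.Surjective p ∧ FlatDimLE n (ModuleCat.of R (LinearMap.ker p))

/-- Projective dimension at most `n`. -/
def ProjDimLE : ℕ → ModuleCat.{u} R → Prop
  | 0, M => Module.Projective R M
  | n + 1, M => ∃ (G : ModuleCat.{u} R) (p : G →ₗ[R] M),
      Module.Projective R G ∧ Function.Surjective p ∧
        ProjDimLE n (ModuleCat.of R (LinearMap.ker p))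

/-- `R` is a coherent ring: every finitely generated ideal is finitely presented. -/
def IsCoherent : Prop :=
  ∀ I : Ideal R, I.FG → Module.FinitePresentation R I

end Defs

section Helpers

variable {R : Type u} [CommRing R]

theorem exists_factor_surj {P N C : Type u} [AddCommGroup P] [Module R P] [AddCommGroup N]
    [Module R N] [AddCommGroup C] [Module R C] (q : P →ₗ[R] N) (hq : Function.Surjective q)
    (g : P →ₗ[R] C) (hg : ∀ x, q x = 0 → g x = 0) : ∃ h : N →ₗ[R] C, ∀ x, h (q x) = g x := by
  refine ⟨(LinearMap.ker q).liftQ g (fun x hx => hg x hx) ∘ₗ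
    (q.quotKerEquivOfSurjective hq).symm.toLinearMap, fun x => ?_⟩
  have : (q.quotKerEquivOfSurjective hq).symm (q x) = Submodule.Quotient.mk x := by
    rw [LinearEquiv.symm_apply_eq]; rfl
  simp only [LinearMap.comp_apply, LinearEquiv.coe_coe, this]
  rfl

theorem exists_factor_inj {P N C : Type u} [AddCommGroup P] [Module R P] [AddCommGroup N]
    [Module R N] [AddCommGroup C] [Module R C] (j : N →ₗ[R] P) (hj : Function.Injective j)
    (g : C →ₗ[R] P) (hg : ∀ x, ∃ n, j n = g x) : ∃ h : C →ₗ[R] N, ∀ x, j (h x) = g x := by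
  refine ⟨(LinearEquiv.ofInjective j hj).symm.toLinearMap ∘ₗ
    g.codRestrict (LinearMap.range j) (fun x => hg x), fun x => ?_⟩
  have := LinearEquiv.apply_symm_apply (LinearEquiv.ofInjective j hj)
    (g.codRestrict (LinearMap.range j) (fun x => hg x) x)
  exact congrArg Subtype.val this

/-- A short exact sequence `0 → A → P → B → 0` with `P` projective which stays exact under
`Hom(-, Q)` for projective `Q`. -/
def SES (R : Type u) [CommRing R] (A P B : Type u) [AddCommGroup A] [Module R A]
    [AddCommGroup P] [Module R P] [AddCommGroup B] [Module R B] : Prop :=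
  Module.Projective R P ∧ ∃ (j : A →ₗ[R] P) (q : P →ₗ[R] B), Function.Injective j ∧
    Function.Surjective q ∧ (∀ a, q (j a) = 0) ∧ (∀ x, q x = 0 → ∃ a, j a = x) ∧
    ∀ Q : ModuleCat.{u} R, Module.Projective R Q → ∀ u : A →ₗ[R] Q,
      ∃ h : P →ₗ[R] Q, ∀ a, h (j a) = u a

theorem SES.congr_left {A A' P B : Type u} [AddCommGroup A] [Module R A] [AddCommGroup A']
    [Module R A'] [AddCommGroup P] [Module R P] [AddCommGroup B] [Module R B]
    (e : A' ≃ₗ[R] A) (h : SES R A P B) : SES R A' P B := by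
  obtain ⟨hP, j, q, hj, hq, h0, h1, h2⟩ := h
  refine ⟨hP, j ∘ₗ e.toLinearMap, q, hj.comp e.injective, hq, fun a => h0 _, fun x hx => ?_,
    fun Q hQ u => ?_⟩
  · obtain ⟨a, rfl⟩ := h1 x hx
    exact ⟨e.symm a, by simp⟩
  · obtain ⟨h, hh⟩ := h2 Q hQ (u ∘ₗ e.symm.toLinearMap)
    exact ⟨h, fun a => by simp [hh]⟩

theorem sg_iff (N : Type u) [AddCommGroup N] [Module R N] :
    IsSGProjective R N ↔ ∃ P : ModuleCat.{u} R, SES R N P N := by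
  constructor
  · rintro ⟨P, hP, f, hf, hk, ⟨e⟩, hQ⟩
    refine ⟨P, hP, (LinearMap.range f).subtype ∘ₗ e.toLinearMap,
      e.symm.toLinearMap ∘ₗ f.rangeRestrict, ?_, ?_, ?_, ?_, ?_⟩
    · exact Subtype.val_injective.comp e.injective
    · exact e.symm.surjective.comp f.surjective_rangeRestrict
    · intro a
      have : (e a : P) ∈ LinearMap.ker f := by rw [hk]; exact (e a).2
      simp only [LinearMap.comp_apply, LinearEquiv.coe_coe, LinearEquiv.map_eq_zero_iff]
      exact Subtype.ext this
    · intro x hx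
      simp only [LinearMap.comp_apply, LinearEquiv.coe_coe, LinearEquiv.map_eq_zero_iff] at hx
      have hx' : x ∈ LinearMap.ker f := congrArg Subtype.val hx
      rw [hk] at hx'
      exact ⟨e.symm ⟨x, hx'⟩, by simp⟩
    · intro Q hQ' u
      obtain ⟨h, hh⟩ := hQ Q hQ' (u ∘ₗ e.symm.toLinearMap ∘ₗ f.rangeRestrict) (by
        ext x
        have : f.rangeRestrict (f x) = 0 := Subtype.ext (LinearMap.congr_fun hf x)
        simp [this])
      refine ⟨h, fun a => ?_⟩
      obtain ⟨x, hx⟩ := f.surjective_rangeRestrict (e a)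
      have h3 := LinearMap.congr_fun hh x
      simp only [LinearMap.comp_apply, LinearEquiv.coe_coe, hx, LinearEquiv.symm_apply_apply] at h3
      rw [h3]
      simp only [LinearMap.comp_apply, LinearEquiv.coe_coe, Submodule.subtype_apply, ← hx]
      rfl
  · rintro ⟨P, hP, j, q, hj, hq, h0, h1, h2⟩
    have hr : LinearMap.range (j ∘ₗ q) = LinearMap.range j :=
      LinearMap.range_comp_of_range_eq_top _ (LinearMap.range_eq_top.2 hq)
    refine ⟨P, hP, j ∘ₗ q, ?_, ?_, ?_, ?_⟩
    · ext x; simp [h0]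
    · rw [hr]
      ext x
      constructor
      · intro hx
        exact h1 x (hj (by simpa using hx))
      · rintro ⟨a, rfl⟩
        simp [h0]
    · exact ⟨(LinearEquiv.ofInjective j hj).trans (LinearEquiv.ofEq _ _ hr.symm)⟩
    · intro Q hQ g hg
      obtain ⟨u, hu⟩ := exists_factor_surj q hq g (fun x hx => by
        obtain ⟨a, rfl⟩ := h1 x hx
        obtain ⟨y, rfl⟩ := hq a
        exact LinearMap.congr_fun hg y)
      obtain ⟨h, hh⟩ := h2 Q hQ u
      exact ⟨h, by ext x; simp [hh, hu]⟩

theorem SES.prod_proj {N P T : Type u} [AddCommGroup N] [Module R N] [AddCommGroup P]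
    [Module R P] [AddCommGroup T] [Module R T] (hT : Module.Projective R T)
    (h : SES R N P N) : SES R (N × T) (P × T × T) (N × T) := by
  obtain ⟨hP, j, q, hj, hq, h0, h1, h2⟩ := h
  refine ⟨inferInstance, j.prodMap (LinearMap.inl R T T), q.prodMap (LinearMap.snd R T T),
    ?_, ?_, ?_, ?_, ?_⟩
  · rintro ⟨a, b⟩ ⟨c, d⟩ hh
    simp only [LinearMap.prodMap_apply, LinearMap.inl_apply, Prod.mk.injEq] at hh
    rw [hj hh.1, hh.2.1]
  · rintro ⟨a, b⟩
    obtain ⟨x, rfl⟩ := hq a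
    exact ⟨(x, 0, b), rfl⟩
  · rintro ⟨a, b⟩
    simp [h0]
  · rintro ⟨x, y, z⟩ hh
    simp only [LinearMap.prodMap_apply, LinearMap.snd_apply, Prod.mk_eq_zero] at hh
    obtain ⟨a, rfl⟩ := h1 x hh.1
    exact ⟨(a, y), by simp [hh.2]⟩
  · intro Q hQ u
    obtain ⟨h, hh⟩ := h2 Q hQ (u ∘ₗ LinearMap.inl R N T)
    refine ⟨h.coprod ((u ∘ₗ LinearMap.inr R N T) ∘ₗ LinearMap.fst R T T), ?_⟩
    rintro ⟨a, b⟩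
    simp [hh, ← map_add]

/-- Retracts of modules fitting in a one-periodic sequence. -/
def Retr (R : Type u) [CommRing R] (A : ModuleCat.{u} R) : Prop :=
  ∃ N P : ModuleCat.{u} R, SES R N P N ∧
    ∃ (i : A →ₗ[R] N) (r : N →ₗ[R] A), ∀ a, r (i a) = a

theorem Retr.coker {A : ModuleCat.{u} R} (hA : Retr R A) :
    ∃ B : ModuleCat.{u} R, Retr R B ∧ ∃ P : ModuleCat.{u} R, SES R A P B := by
  obtain ⟨N, P, hS, i, r, hir⟩ := hA
  have hS' := hS
  obtain ⟨hP, j, q, hj, hq, h0, h1, h2⟩ := hS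
  obtain ⟨ρ, hρ⟩ := h2 P hP (j ∘ₗ i ∘ₗ r)
  simp only [LinearMap.comp_apply] at hρ
  let K : Submodule R P := LinearMap.range (j ∘ₗ i)
  obtain ⟨t, ht⟩ := exists_factor_surj q hq (K.mkQ ∘ₗ ρ) (fun x hx => by
    obtain ⟨n, rfl⟩ := h1 x hx
    simp only [LinearMap.comp_apply, hρ]
    rw [Submodule.mkQ_apply, Submodule.Quotient.mk_eq_zero]
    exact ⟨r n, rfl⟩)
  refine ⟨ModuleCat.of R (P ⧸ K), ⟨ModuleCat.of R (N × P), ModuleCat.of R (P × P × P),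
    hS'.prod_proj hP, ?_⟩, P, hP, j ∘ₗ i, K.mkQ, ?_, K.mkQ_surjective, ?_, ?_, ?_⟩
  · refine ⟨K.liftQ (q.prod (LinearMap.id - ρ)) ?_, t.coprod K.mkQ, ?_⟩
    · rintro _ ⟨a, rfl⟩
      simp [h0, hρ, hir]
    · intro c
      obtain ⟨x, rfl⟩ := K.mkQ_surjective c
      change t (q x) + K.mkQ (x - ρ x) = K.mkQ x
      rw [ht, LinearMap.comp_apply, ← map_add]
      simp
  · exact hj.comp (Function.LeftInverse.injective hir)
  · intro a
    exact (Submodule.Quotient.mk_eq_zero K).2 ⟨a, rfl⟩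
  · intro x hx
    exact (Submodule.Quotient.mk_eq_zero K).1 hx
  · intro Q hQ u
    obtain ⟨h, hh⟩ := h2 Q hQ (u ∘ₗ r)
    exact ⟨h, fun a => by simp [hh, hir]⟩

theorem Retr.syz {A : ModuleCat.{u} R} (hA : Retr R A) :
    ∃ B : ModuleCat.{u} R, Retr R B ∧ ∃ P : ModuleCat.{u} R, SES R B P A := by
  obtain ⟨N, P, hS, i, r, hir⟩ := hA
  have hS' := hS
  obtain ⟨hP, j, q, hj, hq, h0, h1, h2⟩ := hS
  obtain ⟨σ, hσ'⟩ := Module.projective_lifting_property q (i ∘ₗ r ∘ₗ q) hq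
  have hσ : ∀ x, q (σ x) = i (r (q x)) := fun x => LinearMap.congr_fun hσ' x
  let K : Submodule R P := LinearMap.ker (r ∘ₗ q)
  have hK : ∀ k : K, r (q k) = 0 := fun k => k.2
  obtain ⟨s, hs⟩ := exists_factor_inj j hj (σ ∘ₗ K.subtype) (fun k => h1 _ (by
    simp [hσ, hK]))
  let jK : N →ₗ[R] K := j.codRestrict K (fun n => by
    change r (q (j n)) = 0
    simp [h0])
  let τ : P →ₗ[R] K := (LinearMap.id - σ).codRestrict K (fun x => by
    change r (q (x - σ x)) = 0
    simp [hσ, hir])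
  have key : ∀ k : K, jK (s k) + τ k = k := fun k => by
    apply Subtype.ext
    change j (s k) + ((k : P) - σ k) = k
    rw [hs]; simp
  refine ⟨ModuleCat.of R K, ⟨ModuleCat.of R (N × P), ModuleCat.of R (P × P × P),
    hS'.prod_proj hP, ?_⟩, P, hP, K.subtype, r ∘ₗ q, Subtype.val_injective, ?_, hK, ?_, ?_⟩
  · exact ⟨s.prod K.subtype, jK.coprod τ, key⟩
  · exact (Function.RightInverse.surjective hir).comp hq
  · intro x hx
    exact ⟨⟨x, hx⟩, rfl⟩
  · intro Q hQ u
    obtain ⟨h, hh⟩ := h2 Q hQ (u ∘ₗ jK)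
    refine ⟨u ∘ₗ τ + h ∘ₗ σ, fun k => ?_⟩
    have h3 : h (σ k) = u (jK (s k)) := by
      have := hh (s k)
      rw [hs] at this
      exact this
    change u (τ k) + h (σ k) = u k
    rw [h3, ← map_add, add_comm, key]

theorem exists_int_seq {α : Type*} (r : α → α → Prop) (h1 : ∀ a, ∃ b, r a b)
    (h2 : ∀ a, ∃ b, r b a) (a : α) : ∃ z : ℤ → α, z 1 = a ∧ ∀ i, r (z (i + 1)) (z i) := by
  choose f hf using h1
  choose g hg using h2
  let z : ℤ → α := fun i => match i with
    | Int.ofNat n => g^[n] a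
    | Int.negSucc n => f^[n + 1] a
  have hz : ∀ i, r (z (i + 1)) (z i) := by
    intro i
    rcases i with n | n
    · change r (g^[n + 1] a) (g^[n] a)
      rw [Function.iterate_succ_apply']
      exact hg _
    · rcases n with _ | n
      · change r a (f a)
        exact hf _
      · change r (f^[n + 1] a) (f^[n + 1 + 1] a)
        rw [Function.iterate_succ_apply' f (n + 1)]
        exact hf _
  refine ⟨fun i => z (i - 1), rfl, fun i => ?_⟩
  have := hz (i - 1)
  rwa [show i - 1 + 1 = i + 1 - 1 by ring] at this

theorem Retr.gproj {M : ModuleCat.{u} R} (hM : Retr R M) : IsGProjective R M := by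
  obtain ⟨z, hz1, hz⟩ := exists_int_seq
    (fun A B : {A : ModuleCat.{u} R // Retr R A} => ∃ P : ModuleCat.{u} R, SES R A.1 P B.1)
    (fun A => by
      obtain ⟨B, hB, h⟩ := A.2.coker
      exact ⟨⟨B, hB⟩, h⟩)
    (fun A => by
      obtain ⟨B, hB, h⟩ := A.2.syz
      exact ⟨⟨B, hB⟩, h⟩) ⟨M, hM⟩
  have hMz : M = (z 1).1 := by rw [hz1]
  choose P hP j q hj hq h0 h1 h2 using hz
  have hr : ∀ i, LinearMap.range (j i ∘ₗ q (i + 1)) = LinearMap.range (j i) := fun i =>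
    LinearMap.range_comp_of_range_eq_top _ (LinearMap.range_eq_top.2 (hq _))
  refine ⟨P, fun i => j i ∘ₗ q (i + 1), hP, ?_, ?_, ?_, ?_⟩
  · intro i
    ext x
    simp [h0]
  · intro i
    rw [hr]
    ext x
    constructor
    · intro hx
      exact h1 _ x (hj i (by simpa using hx))
    · rintro ⟨a, rfl⟩
      simp [h0]
  · rw [hMz]
    exact ⟨(LinearEquiv.ofInjective (j 0) (hj 0)).trans (LinearEquiv.ofEq _ _ (hr 0).symm)⟩
  · intro Q hQ i g hg
    obtain ⟨u, hu⟩ := exists_factor_surj (q (i + 1)) (hq _) g (fun x hx => by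
      obtain ⟨a, rfl⟩ := h1 _ x hx
      obtain ⟨y, rfl⟩ := hq _ a
      exact LinearMap.congr_fun hg y)
    obtain ⟨h, hh⟩ := h2 i Q hQ u
    exact ⟨h, by ext x; simp [hh, hu]⟩

theorem SES.directSum {A P B : ℤ → Type u} [∀ i, AddCommGroup (A i)] [∀ i, Module R (A i)]
    [∀ i, AddCommGroup (P i)] [∀ i, Module R (P i)] [∀ i, AddCommGroup (B i)]
    [∀ i, Module R (B i)] (h : ∀ i, SES R (A i) (P i) (B i)) :
    SES R (⨁ i, A i) (⨁ i, P i) (⨁ i, B i) := by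
  choose hP j q hj hq h0 h1 h2 using h
  refine ⟨inferInstance, DirectSum.lmap j, DirectSum.lmap q, (DirectSum.lmap_injective _).2 hj,
    (DirectSum.lmap_surjective _).2 hq, ?_, ?_, ?_⟩
  · intro a
    ext i
    simp [h0]
  · intro x hx
    have : x ∈ LinearMap.range (DirectSum.lmap j) := by
      rw [DirectSum.range_lmap]
      intro i _
      exact h1 i _ (DFunLike.congr_fun hx i)
    exact this
  · intro Q hQ u
    choose h hh using fun i => h2 i Q hQ (u ∘ₗ DirectSum.lof R ℤ A i)
    refine ⟨DirectSum.toModule R ℤ Q h, fun a => ?_⟩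
    have : DirectSum.toModule R ℤ Q h ∘ₗ DirectSum.lmap j = u := by
      refine DirectSum.linearMap_ext R fun i => ?_
      ext x
      simp [hh]
    exact LinearMap.congr_fun this a

theorem gproj_retract {M : Type u} [AddCommGroup M] [Module R M] (hM : IsGProjective R M) :
    ∃ N P : ModuleCat.{u} R, SES R N P N ∧
      ∃ (i : M →ₗ[R] N) (r : N →ₗ[R] M), r ∘ₗ i = LinearMap.id := by
  obtain ⟨P, d, hP, hd, hk, ⟨e⟩, hQ⟩ := hM
  have hS : ∀ i, SES R (LinearMap.range (d (i + 1))) (P (i + 1)) (LinearMap.range (d i)) := by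
    intro i
    refine ⟨hP _, Submodule.subtype _, (d i).rangeRestrict, Subtype.val_injective,
      (d i).surjective_rangeRestrict, ?_, ?_, ?_⟩
    · intro a
      have : (a : P (i + 1)) ∈ LinearMap.ker (d i) := by rw [hk]; exact a.2
      exact Subtype.ext this
    · intro x hx
      have hx' : x ∈ LinearMap.ker (d i) := congrArg Subtype.val hx
      rw [hk] at hx'
      exact ⟨⟨x, hx'⟩, rfl⟩
    · intro Q hQ' u
      obtain ⟨h, hh⟩ := hQ Q hQ' (i + 1) (u ∘ₗ (d (i + 1)).rangeRestrict) (by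
        ext x
        have : (d (i + 1)).rangeRestrict (d (i + 1 + 1) x) = 0 :=
          Subtype.ext (LinearMap.congr_fun (hd (i + 1)) x)
        simp [this])
      refine ⟨h, ?_⟩
      rintro ⟨_, x, rfl⟩
      exact (LinearMap.congr_fun hh x).symm
  have hD := SES.directSum hS
  let E : (⨁ i : ℤ, LinearMap.range (d i)) ≃ₗ[R] ⨁ i : ℤ, LinearMap.range (d (i + 1)) :=
    DirectSum.lequivCongrLeft R (M := fun i : ℤ => LinearMap.range (d i)) (Equiv.addRight (1 : ℤ)).symm
  refine ⟨ModuleCat.of R (⨁ i : ℤ, LinearMap.range (d i)), ModuleCat.of R (⨁ i : ℤ, P (i + 1)),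
    hD.congr_left E,
    DirectSum.lof R ℤ (fun i : ℤ => LinearMap.range (d i)) 0 ∘ₗ e.toLinearMap,
    e.symm.toLinearMap ∘ₗ DirectSum.component R ℤ (fun i : ℤ => LinearMap.range (d i)) 0, ?_⟩
  ext m
  simp [DirectSum.component.lof_self]

end Helpers

/-- An `R`-module is Gorenstein projective iff it is a direct summand of a
strongly Gorenstein projective `R`-module. -/
theorem stmt2 (R : Type u) [CommRing R] (M : Type u) [AddCommGroup M] [Module R M] :
    IsGProjective R M ↔
      ∃ N : ModuleCat.{u} R, IsSGProjective R N ∧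
        ∃ (i : M →ₗ[R] N) (r : N →ₗ[R] M), r ∘ₗ i = LinearMap.id := by
  constructor
  · intro hM
    obtain ⟨N, P, hS, h⟩ := gproj_retract hM
    exact ⟨N, (sg_iff N).2 ⟨P, hS⟩, h⟩
  · rintro ⟨N, hN, i, r, h⟩
    obtain ⟨P, hS⟩ := (sg_iff N).1 hN
    exact Retr.gproj (M := ModuleCat.of R M)
      ⟨N, P, hS, i, r, fun a => LinearMap.congr_fun h a⟩
end

section
/- If the class of strongly Gorenstein projective R-modules is projectively resolving, then it coincides with the class of Gorenstein projective R-modules; conversely, if every Gorenstein projective R-module is strongly Gorenstein projective, then the class of strongly Gorenstein projective modules is projectively resolving. -/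
universe u

open LinearMap DirectSum

namespace SGP

variable {R : Type u} [CommRing R]

/-- Short exact sequences. -/
def SES {A B C : Type u} [AddCommGroup A] [Module R A] [AddCommGroup B] [Module R B]
    [AddCommGroup C] [Module R C] (i : A →ₗ[R] B) (p : B →ₗ[R] C) : Prop :=
  Function.Injective i ∧ Function.Surjective p ∧ Function.Exact i p

/-- Vanishing of `Ext¹(C, Q)` for all projective `Q`, as an extension property. -/
def EV (R : Type u) [CommRing R] (C : Type u) [AddCommGroup C] [Module R C] : Prop :=
  ∀ (X Y Q : ModuleCat.{u} R) (i : X →ₗ[R] Y) (p : Y →ₗ[R] C), SES i p →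
    Module.Projective R Q → ∀ g : X →ₗ[R] Q, ∃ h : Y →ₗ[R] Q, h ∘ₗ i = g

/-- `0 → M → P → N → 0` with `P` projective. -/
def Step (M N : ModuleCat.{u} R) : Prop :=
  ∃ (P : ModuleCat.{u} R) (i : M →ₗ[R] P) (p : P →ₗ[R] N), Module.Projective R P ∧ SES i p

theorem liftInj {A B C : Type u} [AddCommGroup A] [Module R A] [AddCommGroup B] [Module R B]
    [AddCommGroup C] [Module R C] (i : A →ₗ[R] B) (hi : Function.Injective i)
    (u : C →ₗ[R] B) (hu : ∀ c, ∃ a, i a = u c) : ∃ v : C →ₗ[R] A, ∀ c, i (v c) = u c := by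
  refine ⟨(LinearEquiv.ofInjective i hi).symm.toLinearMap ∘ₗ
    u.codRestrict (LinearMap.range i) (fun c => hu c), fun c => ?_⟩
  have := LinearEquiv.apply_symm_apply (LinearEquiv.ofInjective i hi)
    (u.codRestrict (LinearMap.range i) (fun c => hu c) c)
  exact congrArg Subtype.val this

theorem descend {A B C : Type u} [AddCommGroup A] [Module R A] [AddCommGroup B] [Module R B]
    [AddCommGroup C] [Module R C] (p : A →ₗ[R] B) (hp : Function.Surjective p)
    (u : A →ₗ[R] C) (hu : ∀ a, p a = 0 → u a = 0) : ∃ v : B →ₗ[R] C, ∀ a, v (p a) = u a := by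
  refine ⟨(LinearMap.ker p).liftQ u (fun a ha => hu a ha) ∘ₗ
    (p.quotKerEquivOfSurjective hp).symm.toLinearMap, fun a => ?_⟩
  have : (p.quotKerEquivOfSurjective hp).symm (p a) = Submodule.Quotient.mk a := by
    rw [LinearEquiv.symm_apply_eq]; rfl
  rw [LinearMap.comp_apply, LinearEquiv.coe_coe, this]
  rfl

theorem projLift {P B C : Type u} [AddCommGroup P] [Module R P] [AddCommGroup B] [Module R B]
    [AddCommGroup C] [Module R C] (hP : Module.Projective R P) (p : B →ₗ[R] C)
    (hp : Function.Surjective p) (u : P →ₗ[R] C) : ∃ v : P →ₗ[R] B, ∀ x, p (v x) = u x := by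
  obtain ⟨v, hv⟩ := Module.projective_lifting_property p u hp
  exact ⟨v, fun x => LinearMap.congr_fun hv x⟩

/-- Vanishing may be tested on one projective presentation. -/
theorem EV_of_pres {C : Type u} [AddCommGroup C] [Module R C] (X P : ModuleCat.{u} R)
    (hP : Module.Projective R P) (j : X →ₗ[R] P) (q : P →ₗ[R] C) (hs : SES j q)
    (H : ∀ (Q : ModuleCat.{u} R), Module.Projective R Q → ∀ g : X →ₗ[R] Q,
      ∃ h : P →ₗ[R] Q, ∀ x, h (j x) = g x) : EV R C := by
  intro X' Y Q i p ⟨hi, hp, hip⟩ hQ g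
  obtain ⟨hj, hq, hjq⟩ := hs
  obtain ⟨u, hu⟩ := projLift hP p hp q
  obtain ⟨v, hv⟩ := liftInj i hi (u ∘ₗ j) (fun x => by
    apply (hip _).1; simp [hu, hjq.apply_apply_eq_zero])
  obtain ⟨h, hh⟩ := H Q hQ (g ∘ₗ v)
  obtain ⟨k, hk⟩ := descend (i.coprod u) (by
    intro y
    obtain ⟨x, hx⟩ := hq (p y)
    obtain ⟨a, ha⟩ := (hip (y - u x)).1 (by simp [hu, hx])
    exact ⟨(a, x), by simp [ha]⟩) (g.coprod h) (by
    rintro ⟨a, x⟩ hax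
    simp only [LinearMap.coprod_apply] at hax ⊢
    have h1 : q x = 0 := by
      have := congrArg p hax
      simpa [hip.apply_apply_eq_zero, hu] using this
    obtain ⟨b, rfl⟩ := (hjq x).1 h1
    have h2 : a + v b = 0 := by
      apply hi
      have := hv b
      simp only [LinearMap.comp_apply] at this
      rw [map_add, this, hax, map_zero]
    rw [hh, LinearMap.comp_apply, ← map_add, h2, map_zero])
  refine ⟨k, LinearMap.ext fun a => ?_⟩
  have := hk (a, 0)
  simpa using this

theorem EV_ext {A B C : Type u} [AddCommGroup A] [Module R A] [AddCommGroup B] [Module R B]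
    [AddCommGroup C] [Module R C] (i : A →ₗ[R] B) (p : B →ₗ[R] C) (hs : SES i p)
    (hA : EV R A) (hC : EV R C) : EV R B := by
  intro X Y Q j q ⟨hj, hq, hjq⟩ hQ g
  obtain ⟨hi, hp, hip⟩ := hs
  let Y' := LinearMap.ker (p ∘ₗ q)
  obtain ⟨v, hv⟩ := liftInj i hi (q ∘ₗ Y'.subtype) (fun y => (hip _).1 y.2)
  simp only [LinearMap.comp_apply, Submodule.subtype_apply] at hv
  obtain ⟨h, hh⟩ := hA X (ModuleCat.of R Y') Q
    (j.codRestrict Y' (fun x => by simp [Y', hjq.apply_apply_eq_zero])) v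
    ⟨fun a b hab => hj (congrArg Subtype.val hab), fun a => by
      obtain ⟨y, hy⟩ := hq (i a)
      refine ⟨⟨y, by simp [Y', hy, hip.apply_apply_eq_zero]⟩, hi ?_⟩
      rw [hv]; exact hy, fun y => by
      rw [← hi.eq_iff, hv, map_zero, hjq]
      constructor
      · rintro ⟨x, hx⟩; exact ⟨x, Subtype.ext hx⟩
      · rintro ⟨x, hx⟩; exact ⟨x, congrArg Subtype.val hx⟩⟩ hQ g
  obtain ⟨k, hk⟩ := hC (ModuleCat.of R Y') Y Q Y'.subtype (p ∘ₗ q)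
    ⟨Subtype.val_injective, hp.comp hq, LinearMap.exact_subtype_ker_map _⟩ hQ h
  refine ⟨k, LinearMap.ext fun x => ?_⟩
  rw [← hh, ← hk]; rfl

theorem EV_retract {A Z : Type u} [AddCommGroup A] [Module R A] [AddCommGroup Z] [Module R Z]
    (a : A →ₗ[R] Z) (r : Z →ₗ[R] A) (hr : ∀ x, r (a x) = x) (hZ : EV R Z) : EV R A := by
  intro X Y Q j q ⟨hj, hq, hjq⟩ hQ g
  let Y' := LinearMap.ker (q ∘ₗ LinearMap.fst R Y Z - r ∘ₗ LinearMap.snd R Y Z)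
  have hY' : ∀ y : Y × Z, y ∈ Y' ↔ q y.1 = r y.2 := fun y => by simp [Y', sub_eq_zero]
  obtain ⟨h, hh⟩ := hZ X (ModuleCat.of R Y') Q
    ((LinearMap.inl R Y Z ∘ₗ j).codRestrict Y' (fun x => by
      simp [hY', hjq.apply_apply_eq_zero])) (LinearMap.snd R Y Z ∘ₗ Y'.subtype)
    ⟨fun a b hab => hj (congrArg (fun t => t.1.1) hab), fun z => by
      obtain ⟨y, hy⟩ := hq (r z)
      exact ⟨⟨(y, z), by simp [hY', hy]⟩, rfl⟩, fun y => by
      constructor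
      · intro hy
        have hy' : y.1.2 = 0 := hy
        have h2 := (hY' _).1 y.2
        rw [hy', map_zero] at h2
        obtain ⟨x, hx⟩ := (hjq _).1 h2
        exact ⟨x, Subtype.ext (Prod.ext hx hy'.symm)⟩
      · rintro ⟨x, rfl⟩; rfl⟩ hQ g
  refine ⟨h ∘ₗ (LinearMap.prod LinearMap.id (a ∘ₗ q)).codRestrict Y' (fun y => by
    simp [hY', hr]), LinearMap.ext fun x => ?_⟩
  rw [← hh]
  simp only [LinearMap.comp_apply]
  congr 1
  apply Subtype.ext
  change ((j x, a (q (j x))) : Y × Z) = (j x, 0)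
  rw [hjq.apply_apply_eq_zero, map_zero]

theorem chain {α : Type*} (r : α → α → Prop) (h1 : ∀ a, ∃ b, r a b) (h2 : ∀ a, ∃ b, r b a)
    (a : α) : ∃ s : ℤ → α, s 1 = a ∧ ∀ i, r (s (i + 1)) (s i) := by
  choose nx hn using h1
  choose pv hp using h2
  let s : ℤ → α := fun i => match i with
    | Int.ofNat n => pv^[n] a
    | Int.negSucc n => nx^[n + 1] a
  have hs : ∀ i, r (s (i + 1)) (s i) := by
    intro i
    match i with
    | Int.ofNat n =>
      change r (pv^[n + 1] a) (pv^[n] a)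
      rw [Function.iterate_succ_apply']; exact hp _
    | Int.negSucc 0 => exact hn a
    | Int.negSucc (n + 1) =>
      change r (nx^[n + 1] a) (nx^[n + 1 + 1] a)
      rw [Function.iterate_succ_apply' nx (n + 1)]; exact hn _
  refine ⟨fun i => s (i - 1), rfl, fun i => ?_⟩
  have := hs (i - 1)
  rwa [show i - 1 + 1 = i + 1 - 1 by ring] at this

theorem G_of_class (W : ModuleCat.{u} R → Prop) (hE : ∀ M, W M → EV R M)
    (h1 : ∀ M, W M → ∃ N, W N ∧ Step M N) (h2 : ∀ M, W M → ∃ N, W N ∧ Step N M)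
    (M : ModuleCat.{u} R) (hM : W M) : IsGProjective R M := by
  obtain ⟨s, hs, hst⟩ := chain (α := {M // W M}) (fun a b => Step a.1 b.1)
    (fun a => by obtain ⟨N, hN, h⟩ := h1 a.1 a.2; exact ⟨⟨N, hN⟩, h⟩)
    (fun a => by obtain ⟨N, hN, h⟩ := h2 a.1 a.2; exact ⟨⟨N, hN⟩, h⟩) ⟨M, hM⟩
  choose P j q hP hses using hst
  have hker : ∀ i, LinearMap.ker (j i ∘ₗ q (i + 1)) =
      LinearMap.range (j (i + 1) ∘ₗ q (i + 1 + 1)) := by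
    intro i
    rw [LinearMap.ker_comp_of_ker_eq_bot _ (LinearMap.ker_eq_bot.2 (hses i).1),
      LinearMap.range_comp_of_range_eq_top _ (LinearMap.range_eq_top.2 (hses (i + 1 + 1)).2.1),
      (hses (i + 1)).2.2.linearMap_ker_eq]
  refine ⟨P, fun i => j i ∘ₗ q (i + 1), hP, fun i => ?_, hker, ?_, ?_⟩
  · ext x
    have : (j (i + 1) ∘ₗ q (i + 1 + 1)) x ∈ LinearMap.ker (j i ∘ₗ q (i + 1)) := by
      rw [hker]; exact ⟨x, rfl⟩
    exact this
  · have hr : LinearMap.range (j 0 ∘ₗ q (0 + 1)) = LinearMap.range (j 0) :=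
      LinearMap.range_comp_of_range_eq_top _ (LinearMap.range_eq_top.2 (hses (0 + 1)).2.1)
    have e0 := LinearEquiv.ofInjective (j 0) (hses 0).1
    have hM0 : M = (s (0 + 1)).1 := by rw [zero_add, hs]
    rw [hr]
    exact ⟨(hM0 ▸ LinearEquiv.refl R M : M ≃ₗ[R] (s (0 + 1)).1).trans e0⟩
  · intro Q hQ i g hg
    obtain ⟨g', hg'⟩ := descend (q (i + 1)) (hses _).2.1 g (by
      intro x hx
      obtain ⟨y, rfl⟩ := ((hses (i + 1)).2.2 x).1 hx
      obtain ⟨z, rfl⟩ := (hses (i + 1 + 1)).2.1 y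
      exact LinearMap.congr_fun hg z)
    obtain ⟨h, hh⟩ := hE _ (s i).2 _ _ Q (j i) (q i) (hses i) hQ g'
    refine ⟨h, LinearMap.ext fun x => ?_⟩
    rw [← hg', ← hh]; rfl

theorem G_of_SG (M : ModuleCat.{u} R) (h : IsSGProjective R M) : IsGProjective R M := by
  obtain ⟨P, hP, f, hf, hk, hM, hQ⟩ := h
  exact ⟨fun _ => P, fun _ => f, fun _ => hP, fun _ => hf, fun _ => hk, hM,
    fun Q hQ' _ g hg => hQ Q hQ' g hg⟩

theorem SG_data (M : ModuleCat.{u} R) (h : IsSGProjective R M) : Step M M ∧ EV R M := by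
  obtain ⟨P, hP, f, hf, hk, ⟨e⟩, hQ⟩ := h
  let j : M →ₗ[R] P := (LinearMap.range f).subtype ∘ₗ e.toLinearMap
  let q : P →ₗ[R] M := e.symm.toLinearMap ∘ₗ f.rangeRestrict
  have hjq : ∀ x, j (q x) = f x := fun x => by simp [j, q]
  have hs : SES j q := by
    refine ⟨Subtype.val_injective.comp e.injective,
      e.symm.surjective.comp f.surjective_rangeRestrict, ?_⟩
    rw [LinearMap.exact_iff]
    have h1 : LinearMap.ker q = LinearMap.ker f := by
      ext x; simp [q]
    have h2 : LinearMap.range j = LinearMap.range f := by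
      ext x
      constructor
      · rintro ⟨y, rfl⟩; exact (e y).2
      · rintro ⟨y, rfl⟩; exact ⟨q y, hjq y⟩
    rw [h1, h2, hk]
  refine ⟨⟨P, j, q, hP, hs⟩, EV_of_pres M P hP j q hs fun Q hQ' g => ?_⟩
  obtain ⟨h, hh⟩ := hQ Q hQ' (g ∘ₗ q) (by
    ext x
    have : q (f x) = 0 := (hs.2.2 _).2 ⟨q x, hjq x⟩
    simp [this])
  refine ⟨h, fun x => ?_⟩
  obtain ⟨y, rfl⟩ := hs.2.1 x
  rw [hjq]; exact (LinearMap.congr_fun hh y).symm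

theorem SG_of_proj (P : ModuleCat.{u} R) (hP : Module.Projective R P) : IsSGProjective R P := by
  let f : (P × P) →ₗ[R] (P × P) := LinearMap.inl R P P ∘ₗ LinearMap.snd R P P
  have hr : LinearMap.range f = LinearMap.range (LinearMap.inl R P P) :=
    LinearMap.range_comp_of_range_eq_top _ (LinearMap.range_eq_top.2 LinearMap.snd_surjective)
  refine ⟨ModuleCat.of R (P × P), inferInstanceAs (Module.Projective R (P × P)), f, ?_, ?_, ?_, ?_⟩
  · ext x <;> simp [f]
  · rw [hr]; ext ⟨x, y⟩
    simp only [LinearMap.mem_ker, LinearMap.mem_range]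
    constructor
    · intro h
      have hy : y = 0 := congrArg Prod.fst (show ((y, 0) : P × P) = 0 from h)
      exact ⟨x, by rw [hy]; rfl⟩
    · rintro ⟨z, hz⟩
      have hy : (0 : P) = y := congrArg Prod.snd hz
      subst hy; rfl
  · rw [hr]; exact ⟨LinearEquiv.ofInjective _ LinearMap.inl_injective⟩
  · intro Q _ (g : (P × P) →ₗ[R] Q) hg
    refine ⟨g ∘ₗ LinearMap.inr R P P ∘ₗ LinearMap.fst R P P, ?_⟩
    refine LinearMap.ext fun ⟨x, y⟩ => ?_
    have h0 : g (x, 0) = 0 := LinearMap.congr_fun hg (0, x)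
    have : g (x, y) = g (x, 0) + g (0, y) := by rw [← map_add]; simp
    change g (x, y) = g (0, y)
    rw [this, h0, zero_add]

/-- Extensions. -/
theorem G_ext (A B C : ModuleCat.{u} R) (hA : Step A A ∧ EV R A) (hC : Step C C ∧ EV R C)
    (i : A →ₗ[R] B) (p : B →ₗ[R] C) (hs : SES i p) : IsGProjective R B := by
  refine G_of_class (fun B => ∃ (i : A →ₗ[R] B) (p : B →ₗ[R] C), SES i p) ?_ ?_ ?_ B ⟨i, p, hs⟩
  · rintro B ⟨i, p, hs⟩; exact EV_ext i p hs hA.2 hC.2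
  · clear hs p i B
    rintro B ⟨i, p, hi, hp, hip⟩
    obtain ⟨⟨P, jA, qA, hP, hjA, hqA, hA3⟩, eA⟩ := hA
    obtain ⟨⟨T, jC, qC, hT, hjC, hqC, hC3⟩, eC⟩ := hC
    obtain ⟨k, hk⟩ := eC _ _ P i p ⟨hi, hp, hip⟩ hP jA
    replace hk : ∀ a, k (i a) = jA a := fun a => LinearMap.congr_fun hk a
    let m : B →ₗ[R] (P × T) := LinearMap.prod k (jC ∘ₗ p)
    have hm : ∀ b, m b = (k b, jC (p b)) := fun b => rfl
    let S := LinearMap.range m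
    obtain ⟨w, hw⟩ := descend S.mkQ S.mkQ_surjective (qC ∘ₗ LinearMap.snd R P T) (by
      intro a ha
      rw [Submodule.mkQ_apply, Submodule.Quotient.mk_eq_zero] at ha
      obtain ⟨b, rfl⟩ := ha
      simp [hm, hC3.apply_apply_eq_zero])
    obtain ⟨v, hv⟩ := descend qA hqA (S.mkQ ∘ₗ LinearMap.inl R P T) (by
      intro x hx
      obtain ⟨a, rfl⟩ := (hA3 x).1 hx
      simp only [LinearMap.comp_apply, Submodule.mkQ_apply, Submodule.Quotient.mk_eq_zero]
      exact ⟨i a, by simp [hm, hk, hip.apply_apply_eq_zero]⟩)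
    simp only [LinearMap.comp_apply] at hw hv
    refine ⟨ModuleCat.of R ((P × T) ⧸ S), ⟨v, w, ?_, ?_, ?_⟩, ModuleCat.of R (P × T), m, S.mkQ,
      inferInstanceAs (Module.Projective R (P × T)), ?_, S.mkQ_surjective, ?_⟩
    · rw [injective_iff_map_eq_zero]
      intro a ha
      obtain ⟨x, rfl⟩ := hqA a
      rw [hv, Submodule.mkQ_apply, Submodule.Quotient.mk_eq_zero] at ha
      obtain ⟨b, hb⟩ := ha
      rw [hm] at hb
      have hb1 : k b = x := congrArg Prod.fst hb
      have hb2 : jC (p b) = 0 := congrArg Prod.snd hb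
      obtain ⟨a, rfl⟩ := (hip b).1 (hjC (by rw [hb2, map_zero]))
      rw [← hb1, hk, hA3.apply_apply_eq_zero]
    · intro c
      obtain ⟨t, rfl⟩ := hqC c
      exact ⟨S.mkQ (0, t), hw _⟩
    · intro y
      constructor
      · intro hy
        obtain ⟨⟨x, t⟩, rfl⟩ := S.mkQ_surjective y
        rw [hw] at hy
        obtain ⟨c, hc⟩ := (hC3 t).1 hy
        obtain ⟨b, rfl⟩ := hp c
        refine ⟨qA (x - k b), ?_⟩
        rw [hv, ← sub_eq_zero, ← map_sub, Submodule.mkQ_apply, Submodule.Quotient.mk_eq_zero]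
        exact ⟨-b, by simp [hm, hc]⟩
      · rintro ⟨a, rfl⟩
        obtain ⟨x, rfl⟩ := hqA a
        rw [hv, hw]; simp
    · rw [injective_iff_map_eq_zero]
      intro b hb
      rw [hm] at hb
      have hb1 : k b = 0 := congrArg Prod.fst hb
      have hb2 : jC (p b) = 0 := congrArg Prod.snd hb
      obtain ⟨a, rfl⟩ := (hip b).1 (hjC (by rw [hb2, map_zero]))
      rw [hk] at hb1
      rw [hjA (hb1.trans (map_zero _).symm), map_zero]
    · exact LinearMap.exact_map_mkQ_range m
  · clear hs p i B
    rintro B ⟨i, p, hi, hp, hip⟩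
    obtain ⟨⟨P, jA, qA, hP, hjA, hqA, hA3⟩, eA⟩ := hA
    obtain ⟨⟨T, jC, qC, hT, hjC, hqC, hC3⟩, eC⟩ := hC
    obtain ⟨l, hl⟩ := projLift hT p hp qC
    let m : (P × T) →ₗ[R] B := (i ∘ₗ qA).coprod l
    have hm : ∀ x t, m (x, t) = i (qA x) + l t := fun x t => by simp [m]
    let K := LinearMap.ker m
    have hK : ∀ y : P × T, y ∈ K → qC y.2 = 0 := by
      rintro ⟨x, t⟩ hy
      have := congrArg p (show m (x, t) = 0 from hy)
      simpa [hm, hl, hip.apply_apply_eq_zero] using this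
    obtain ⟨w, hw⟩ := liftInj jC hjC (LinearMap.snd R P T ∘ₗ K.subtype)
      (fun y => (hC3 _).1 (hK _ y.2))
    simp only [LinearMap.comp_apply, Submodule.subtype_apply, LinearMap.snd_apply] at hw
    let v : A →ₗ[R] K := (LinearMap.inl R P T ∘ₗ jA).codRestrict K (fun a => by
      change m (jA a, 0) = 0
      simp [hm, hA3.apply_apply_eq_zero])
    refine ⟨ModuleCat.of R K, ⟨v, w, ?_, ?_, ?_⟩, ModuleCat.of R (P × T), K.subtype, m,
      inferInstanceAs (Module.Projective R (P × T)), Subtype.val_injective, ?_,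
      LinearMap.exact_subtype_ker_map _⟩
    · intro a b hab
      exact hjA (congrArg (fun t => t.1.1) hab)
    · intro c
      obtain ⟨a, ha⟩ := (hip (l (jC c))).1 (by rw [hl, hC3.apply_apply_eq_zero])
      obtain ⟨x, rfl⟩ := hqA a
      refine ⟨⟨(-x, jC c), ?_⟩, hjC ?_⟩
      · change m _ = 0
        simp [hm, ha]
      · rw [hw]
    · intro y
      rw [← hjC.eq_iff, hw, map_zero]
      constructor
      · intro hy
        obtain ⟨⟨x, t⟩, hxt⟩ := y
        simp only at hy
        subst hy
        have h0 : m (x, 0) = 0 := hxt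
        rw [hm, map_zero, add_zero] at h0
        obtain ⟨a, rfl⟩ := (hA3 x).1 (hi (h0.trans (map_zero _).symm))
        exact ⟨a, rfl⟩
      · rintro ⟨a, rfl⟩; rfl
    · intro b
      obtain ⟨t, ht⟩ := hqC (p b)
      obtain ⟨a, ha⟩ := (hip (b - l t)).1 (by simp [hl, ht])
      obtain ⟨x, rfl⟩ := hqA a
      exact ⟨(x, t), by rw [hm, ha]; simp⟩

/-- Kernels of epimorphisms. -/
theorem G_ker (H : ∀ M : ModuleCat.{u} R, IsGProjective R M → IsSGProjective R M)
    (A B C : ModuleCat.{u} R) (hB : IsSGProjective R B) (hC : IsSGProjective R C)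
    (i : A →ₗ[R] B) (p : B →ₗ[R] C) (hs : SES i p) : IsGProjective R A := by
  have ext : ∀ (A B C : ModuleCat.{u} R) (i : A →ₗ[R] B) (p : B →ₗ[R] C), SES i p →
      IsSGProjective R A → IsSGProjective R C → IsSGProjective R B :=
    fun A B C i p hs hA hC => H _ (G_ext A B C (SG_data A hA) (SG_data C hC) i p hs)
  obtain ⟨hi, hp, hip⟩ := hs
  obtain ⟨⟨P, j, q, hP, hj, hq, hjq⟩, -⟩ := SG_data B hB
  let S := LinearMap.range (j ∘ₗ i)
  have hA' : IsSGProjective R (ModuleCat.of R (P ⧸ S)) := by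
    obtain ⟨v, hv⟩ := descend p hp (S.mkQ ∘ₗ j) (by
      intro b hb
      obtain ⟨a, rfl⟩ := (hip b).1 hb
      simp only [LinearMap.comp_apply, Submodule.mkQ_apply, Submodule.Quotient.mk_eq_zero]
      exact ⟨a, rfl⟩)
    obtain ⟨w, hw⟩ := descend S.mkQ S.mkQ_surjective q (by
      intro x hx
      rw [Submodule.mkQ_apply, Submodule.Quotient.mk_eq_zero] at hx
      obtain ⟨a, rfl⟩ := hx
      exact hjq.apply_apply_eq_zero _)
    simp only [LinearMap.comp_apply] at hv
    refine ext C (ModuleCat.of R (P ⧸ S)) B v w ⟨?_, ?_, ?_⟩ hC hB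
    · rw [injective_iff_map_eq_zero]
      intro c hc
      obtain ⟨b, rfl⟩ := hp c
      rw [hv, Submodule.mkQ_apply, Submodule.Quotient.mk_eq_zero] at hc
      obtain ⟨a, ha⟩ := hc
      rw [← hj ha, hip.apply_apply_eq_zero]
    · intro b
      obtain ⟨x, rfl⟩ := hq b
      exact ⟨_, hw x⟩
    · intro y
      constructor
      · intro hy
        obtain ⟨x, rfl⟩ := S.mkQ_surjective y
        rw [hw] at hy
        obtain ⟨b, rfl⟩ := (hjq x).1 hy
        exact ⟨p b, hv b⟩
      · rintro ⟨c, rfl⟩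
        obtain ⟨b, rfl⟩ := hp c
        rw [hv, hw, hjq.apply_apply_eq_zero]
  have stepA : Step A (ModuleCat.of R (P ⧸ S)) :=
    ⟨P, j ∘ₗ i, S.mkQ, hP, hj.comp hi, S.mkQ_surjective, LinearMap.exact_map_mkQ_range _⟩
  obtain ⟨A', hA'SG, P, j, q, hP, hj, hq, hjq⟩ :
    ∃ A' : ModuleCat.{u} R, IsSGProjective R A' ∧ Step A A' := ⟨_, hA', stepA⟩
  obtain ⟨⟨T, jT, qT, hT, hjT, hqT, hT3⟩, -⟩ := SG_data A' hA'SG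
  let Z := LinearMap.ker (q ∘ₗ LinearMap.fst R P T - qT ∘ₗ LinearMap.snd R P T)
  have hZ : ∀ y : P × T, y ∈ Z ↔ q y.1 = qT y.2 := fun y => by simp [Z, sub_eq_zero]
  have hZSG : IsSGProjective R (ModuleCat.of R Z) := by
    refine ext A' (ModuleCat.of R Z) P ((LinearMap.inr R P T ∘ₗ jT).codRestrict Z (fun a => by
      simp [hZ, hT3.apply_apply_eq_zero])) (LinearMap.fst R P T ∘ₗ Z.subtype) ⟨?_, ?_, ?_⟩
      hA'SG (SG_of_proj P hP)
    · intro a b hab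
      exact hjT (congrArg (fun t => t.1.2) hab)
    · intro x
      obtain ⟨t, ht⟩ := hqT (q x)
      exact ⟨⟨(x, t), by simp [hZ, ht]⟩, rfl⟩
    · intro y
      constructor
      · intro hy
        have hy' : y.1.1 = 0 := hy
        have h2 := (hZ _).1 y.2
        rw [hy', map_zero] at h2
        obtain ⟨a, ha⟩ := (hT3 _).1 h2.symm
        exact ⟨a, Subtype.ext (Prod.ext hy'.symm ha)⟩
      · rintro ⟨a, rfl⟩; rfl
  let a : A →ₗ[R] Z := (LinearMap.inl R P T ∘ₗ j).codRestrict Z (fun a => by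
      simp [hZ, hjq.apply_apply_eq_zero])
  let b : Z →ₗ[R] T := LinearMap.snd R P T ∘ₗ Z.subtype
  have ha : Function.Injective a := fun x y hxy => hj (congrArg (fun t => t.1.1) hxy)
  have hb : Function.Surjective b := by
    intro t
    obtain ⟨x, hx⟩ := hq (qT t)
    exact ⟨⟨(x, t), by simp [hZ, hx]⟩, rfl⟩
  have hab : ∀ z, b z = 0 → ∃ x, a x = z := by
    intro y hy
    have hy' : y.1.2 = 0 := hy
    have h2 := (hZ _).1 y.2
    rw [hy', map_zero] at h2
    obtain ⟨a, ha⟩ := (hjq _).1 h2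
    exact ⟨a, Subtype.ext (Prod.ext ha hy'.symm)⟩
  have hba : ∀ x, b (a x) = 0 := fun x => rfl
  obtain ⟨s, hs⟩ := projLift hT b hb LinearMap.id
  simp only [LinearMap.id_apply] at hs
  obtain ⟨r, hr⟩ := liftInj a ha (LinearMap.id - s ∘ₗ b) (fun z => hab _ (by simp [hs]))
  simp only [LinearMap.sub_apply, LinearMap.comp_apply, LinearMap.id_apply] at hr
  have hra : ∀ x, r (a x) = x := fun x => ha (by rw [hr, hba, map_zero, sub_zero])
  have hrs : ∀ t, r (s t) = 0 := fun t => ha (by rw [hr, hs, sub_self, map_zero])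
  obtain ⟨⟨U, jU, qU, hU, hjU, hqU, hU3⟩, hZE⟩ := SG_data _ hZSG
  let K := LinearMap.ker (r ∘ₗ qU)
  have hKSG : IsSGProjective R (ModuleCat.of R K) := by
    refine ext (ModuleCat.of R Z) (ModuleCat.of R K) T (jU.codRestrict K (fun z => by
      simp [K, hU3.apply_apply_eq_zero])) (b ∘ₗ qU ∘ₗ K.subtype) ⟨?_, ?_, ?_⟩
      hZSG (SG_of_proj T hT)
    · intro x y hxy
      exact hjU (congrArg Subtype.val hxy)
    · intro t
      obtain ⟨u, hu⟩ := hqU (s t)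
      refine ⟨⟨u, ?_⟩, ?_⟩
      · change r (qU u) = 0
        rw [hu, hrs]
      · change b (qU u) = t
        rw [hu, hs]
    · intro y
      constructor
      · intro hy
        obtain ⟨x, hx⟩ := hab (qU y.1) hy
        have h3 : r (qU y.1) = 0 := y.2
        rw [← hx, hra] at h3
        rw [h3, map_zero] at hx
        obtain ⟨z, hz⟩ := (hU3 _).1 hx.symm
        exact ⟨z, Subtype.ext hz⟩
      · rintro ⟨z, rfl⟩
        change b (qU (jU z)) = 0
        rw [hU3.apply_apply_eq_zero, map_zero]
  have hrsurj : Function.Surjective r := fun x => ⟨a x, hra x⟩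
  refine G_of_class (fun X => IsSGProjective R X ∨ X = A) ?_ ?_ ?_ A (Or.inr rfl)
  · rintro M (hM | rfl)
    · exact (SG_data M hM).2
    · exact EV_retract a r hra hZE
  · rintro M (hM | rfl)
    · exact ⟨M, Or.inl hM, (SG_data M hM).1⟩
    · exact ⟨_, Or.inl hA', stepA⟩
  · rintro M (hM | rfl)
    · exact ⟨M, Or.inl hM, (SG_data M hM).1⟩
    · exact ⟨ModuleCat.of R K, Or.inl hKSG, U, K.subtype, r ∘ₗ qU, hU, Subtype.val_injective,
        hrsurj.comp hqU,
        LinearMap.exact_subtype_ker_map _⟩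

/-- Countable copowers of strongly Gorenstein projective modules. -/
theorem SG_finsupp (N : ModuleCat.{u} R) (hN : IsSGProjective R N) :
    IsSGProjective R (ModuleCat.of R (ℕ →₀ N)) := by
  obtain ⟨P, hP, f, hf, hk, ⟨e⟩, hQ⟩ := hN
  let F : (ℕ →₀ P) →ₗ[R] (ℕ →₀ P) := Finsupp.mapRange.linearMap f
  let J : (ℕ →₀ N) →ₗ[R] (ℕ →₀ P) :=
    Finsupp.mapRange.linearMap ((LinearMap.range f).subtype ∘ₗ e.toLinearMap)
  have hff : ∀ x, f (f x) = 0 := fun x => LinearMap.congr_fun hf x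
  have hFs : ∀ n x, F (Finsupp.single n x) = Finsupp.single n (f x) := fun n x => by simp [F]
  have hr : ∀ x : ℕ →₀ P, (∀ n, x n ∈ LinearMap.range f) → x ∈ LinearMap.range F := by
    intro x hx
    rw [← Finsupp.sum_single x]
    refine Submodule.sum_mem _ fun n _ => ?_
    obtain ⟨y, hy⟩ := hx n
    exact ⟨Finsupp.single n y, by rw [hFs, hy]⟩
  refine ⟨ModuleCat.of R (ℕ →₀ P), 
    Module.Projective.of_equiv (finsuppLEquivDirectSum R P ℕ).symm, F,
    ?_, ?_, ?_, ?_⟩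
  · refine LinearMap.ext fun x => Finsupp.ext fun n => ?_
    exact hff (x n)
  · apply le_antisymm
    · intro x hx
      refine hr x fun n => ?_
      rw [← hk]
      exact DFunLike.congr_fun (show F x = 0 from hx) n
    · rintro _ ⟨x, rfl⟩
      exact Finsupp.ext fun n => hff (x n)
  · have hJ : Function.Injective J := by
      intro x y hxy
      refine Finsupp.ext fun n => e.injective (Subtype.ext ?_)
      exact DFunLike.congr_fun hxy n
    have : LinearMap.range F = LinearMap.range J := by
      apply le_antisymm
      · rintro _ ⟨x, rfl⟩
        exact ⟨Finsupp.mapRange.linearMap (e.symm.toLinearMap ∘ₗ f.rangeRestrict) x,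
          Finsupp.ext fun n => by simp [F, J]⟩
      · rintro _ ⟨x, rfl⟩
        exact hr _ fun n => (e (x n)).2
    rw [this]
    exact ⟨LinearEquiv.ofInjective J hJ⟩
  · intro Q hQ' (g : (ℕ →₀ P) →ₗ[R] Q) hg
    have : ∀ n, ∃ h : P →ₗ[R] Q, g ∘ₗ Finsupp.lsingle n = h ∘ₗ f := by
      intro n
      refine hQ Q hQ' _ (LinearMap.ext fun x => ?_)
      have := LinearMap.congr_fun hg (Finsupp.single n x)
      rw [LinearMap.comp_apply, hFs] at this
      exact this
    choose h hh using this
    refine ⟨Finsupp.lsum R h, Finsupp.lhom_ext fun n x => ?_⟩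
    rw [LinearMap.comp_apply, hFs]
    erw [Finsupp.lsum_single]
    exact LinearMap.congr_fun (hh n) x

/-- A Gorenstein projective module is a retract of a strongly Gorenstein projective one. -/
theorem G_retract (M : ModuleCat.{u} R) (hM : IsGProjective R M) :
    ∃ (N : ModuleCat.{u} R) (a : M →ₗ[R] N) (r : N →ₗ[R] M), IsSGProjective R N ∧
      ∀ x, r (a x) = x := by
  classical
  obtain ⟨P, d, hP, hdd, hk, ⟨e⟩, hQ⟩ := hM
  let D := Π₀ i : ℤ, P i
  let F : D →ₗ[R] D :=
    { toFun := fun x => (DFinsupp.comapDomain (fun i : ℤ => i + 1)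
        (fun a b h => by simpa using h) x).mapRange (fun i => d i) (fun i => map_zero _)
      map_add' := fun x y => DFinsupp.ext fun i => map_add (d i) (x (i + 1)) (y (i + 1))
      map_smul' := fun c x => DFinsupp.ext fun i => map_smul (d i) c (x (i + 1)) }
  have hF : ∀ x i, F x i = d i (x (i + 1)) := fun x i => rfl
  have hFs : ∀ i (z : P (i + 1)), F (DFinsupp.single (i + 1) z) = DFinsupp.single i (d i z) := by
    intro i z
    refine DFinsupp.ext fun j => ?_
    rw [hF]
    by_cases h : i = j
    · subst h; rw [DFinsupp.single_eq_same, DFinsupp.single_eq_same]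
    · rw [DFinsupp.single_eq_of_ne (fun h' => h (by omega)),
        DFinsupp.single_eq_of_ne (fun h' => h h'.symm), map_zero]
  have hddx : ∀ i z, d i (d (i + 1) z) = 0 := fun i z => LinearMap.congr_fun (hdd i) z
  refine ⟨ModuleCat.of R (LinearMap.range F),
    LinearMap.codRestrict (LinearMap.range F) ((DFinsupp.lsingle (R := R) (M := fun i => P i) 0) ∘ₗ
      (LinearMap.range (d 0)).subtype ∘ₗ e.toLinearMap) ?_,
    e.symm.toLinearMap ∘ₗ LinearMap.codRestrict (LinearMap.range (d 0))
      (DFinsupp.lapply (R := R) (M := fun i => P i) 0 ∘ₗ (LinearMap.range F).subtype) ?_,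
      ⟨ModuleCat.of R D, inferInstanceAs (Module.Projective R (Π₀ i : ℤ, P i)), F, ?_, ?_, ?_, ?_⟩,
      ?_⟩
  · intro m
    obtain ⟨z, hz⟩ := (e m).2
    refine ⟨DFinsupp.single (0 + 1) z, ?_⟩
    rw [hFs, hz]; rfl
  · rintro ⟨_, x, rfl⟩
    exact ⟨x (0 + 1), (hF x 0).symm⟩
  · refine LinearMap.ext fun x => DFinsupp.ext fun i => ?_
    change F (F x) i = 0
    rw [hF, hF, hddx]
  · apply le_antisymm
    · intro (x : D) hx
      replace hx : F x = 0 := hx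
      rw [← DFinsupp.sum_single (f := x)]
      refine Submodule.sum_mem _ fun n _ => ?_
      obtain ⟨i, rfl⟩ : ∃ i, n = i + 1 := ⟨n - 1, by ring⟩
      have h1 : x (i + 1) ∈ LinearMap.ker (d i) := by
        rw [LinearMap.mem_ker, ← hF, hx]; rfl
      rw [hk] at h1
      obtain ⟨z, hz⟩ := h1
      exact ⟨DFinsupp.single (i + 1 + 1) z, by rw [hFs, hz]⟩
    · rintro _ ⟨x, rfl⟩
      refine DFinsupp.ext fun i => ?_
      change F (F x) i = 0
      rw [hF, hF, hddx]
  · exact ⟨LinearEquiv.refl R _⟩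
  · intro Q hQ' (g : D →ₗ[R] Q) hg
    have : ∀ i, ∃ h : P i →ₗ[R] Q, ∀ z : P (i + 1),
        g (DFinsupp.single (i + 1) z) = h (d i z) := by
      intro i
      obtain ⟨h, hh⟩ := hQ Q hQ' i (g ∘ₗ DFinsupp.lsingle (R := R) (M := fun i => P i) (i + 1))
        (LinearMap.ext fun z => by
          have := LinearMap.congr_fun hg (DFinsupp.single (i + 1 + 1) z)
          rw [LinearMap.comp_apply, hFs] at this
          exact this)
      exact ⟨h, fun z => LinearMap.congr_fun hh z⟩
    choose h hh using this
    refine ⟨DFinsupp.lsum ℕ (R := R) (M := fun i => P i) h, ?_⟩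
    refine DFinsupp.lhom_ext (R := R) (M := fun i => P i) fun n x => ?_
    obtain ⟨i, rfl⟩ : ∃ i, n = i + 1 := ⟨n - 1, by ring⟩
    rw [LinearMap.comp_apply, hFs, hh]
    erw [DFinsupp.lsum_single]
  · intro m
    apply e.injective
    apply Subtype.ext
    simp only [LinearMap.comp_apply, LinearEquiv.coe_coe, LinearEquiv.apply_symm_apply]
    exact DFinsupp.single_eq_same (β := fun i : ℤ => P i) (i := 0) (b := (e m : P 0))

/-- The swindle. -/
theorem swindle {M N : Type u} [AddCommGroup M] [Module R M] [AddCommGroup N] [Module R N]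
    (a : M →ₗ[R] N) (r : N →ₗ[R] M) (hr : ∀ x, r (a x) = x) :
    ∃ (i : M →ₗ[R] (ℕ →₀ N)) (p : (ℕ →₀ N) →ₗ[R] (ℕ →₀ N)), SES i p := by
  let sh : (ℕ →₀ N) →ₗ[R] (ℕ →₀ N) := Finsupp.lcomapDomain Nat.succ Nat.succ_injective
  have hsh : ∀ x n, sh x n = x (n + 1) := fun x n => rfl
  let p : (ℕ →₀ N) →ₗ[R] (ℕ →₀ N) :=
    Finsupp.mapRange.linearMap (a ∘ₗ r) ∘ₗ sh + Finsupp.mapRange.linearMap (LinearMap.id - a ∘ₗ r)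
  have hp : ∀ x n, p x n = a (r (x (n + 1))) + (x n - a (r (x n))) := fun x n => by
    simp [p, hsh]
  have hi : ∀ m n, (Finsupp.single 0 (a m) : ℕ →₀ N) (n + 1) = 0 := fun m n => by simp
  refine ⟨Finsupp.lsingle 0 ∘ₗ a, p, ?_, ?_, ?_⟩
  · exact (Finsupp.single_injective 0).comp (Function.LeftInverse.injective hr)
  · intro y
    let up : (ℕ →₀ N) := Finsupp.embDomain ⟨Nat.succ, Nat.succ_injective⟩ y
    have hu : ∀ n, up (n + 1) = y n := fun n =>
      Finsupp.embDomain_apply_self ⟨Nat.succ, Nat.succ_injective⟩ y n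
    have hu0 : up 0 = 0 := Finsupp.embDomain_of_notMem_range _ _ _ (by simp)
    refine ⟨Finsupp.mapRange.linearMap (a ∘ₗ r) up +
      Finsupp.mapRange.linearMap (LinearMap.id - a ∘ₗ r) y, Finsupp.ext fun n => ?_⟩
    rw [hp]
    cases n with
    | zero => simp [hu, hu0, hr]
    | succ n => simp [hu, hr]
  · intro x
    constructor
    · intro hx
      have h1 : ∀ n, r (x (n + 1)) = 0 := fun n => by
        have := congrArg r (DFunLike.congr_fun hx n)
        rw [hp] at this
        simpa [hr] using this
      have h2 : ∀ n, x n = a (r (x n)) := fun n => by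
        have := DFunLike.congr_fun hx n
        rw [hp, h1, map_zero, zero_add] at this
        exact sub_eq_zero.1 this
      refine ⟨r (x 0), Finsupp.ext fun n => ?_⟩
      change (Finsupp.single 0 (a (r (x 0))) : ℕ →₀ N) n = x n
      cases n with
      | zero => rw [Finsupp.single_eq_same, ← h2]
      | succ n => rw [hi, h2, h1, map_zero]
    · rintro ⟨m, rfl⟩
      refine Finsupp.ext fun n => ?_
      rw [hp]
      change a (r ((Finsupp.single 0 (a m) : ℕ →₀ N) (n + 1))) +
        ((Finsupp.single 0 (a m) : ℕ →₀ N) n - a (r ((Finsupp.single 0 (a m) : ℕ →₀ N) n))) = 0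
      rw [hi]
      cases n with
      | zero => simp [hr]
      | succ n => simp

end SGP

/-- If the class of strongly Gorenstein projective `R`-modules is projectively
resolving then it coincides with the class of Gorenstein projective modules; conversely, if
every Gorenstein projective module is strongly Gorenstein projective, then the class of
strongly Gorenstein projective modules is projectively resolving. -/
theorem stmt4 (R : Type u) [CommRing R] :
    (ProjResolving R (fun N : ModuleCat.{u} R => IsSGProjective R N) →
      ∀ M : ModuleCat.{u} R, IsSGProjective R M ↔ IsGProjective R M) ∧
    ((∀ M : ModuleCat.{u} R, IsGProjective R M → IsSGProjective R M) →
      ProjResolving R (fun N : ModuleCat.{u} R => IsSGProjective R N)) := by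
  constructor
  · intro hX M
    refine ⟨SGP.G_of_SG M, fun hM => ?_⟩
    obtain ⟨N, a, r, hN, hr⟩ := SGP.G_retract M hM
    obtain ⟨i, p, hi, hp, hip⟩ := SGP.swindle a r hr
    have hS := SGP.SG_finsupp N hN
    exact (hX.2 M (ModuleCat.of R (ℕ →₀ N)) (ModuleCat.of R (ℕ →₀ N)) i p hi hp
      hip.linearMap_ker_eq.symm hS).2 hS
  · intro H
    refine ⟨SGP.SG_of_proj, fun A B C i p hi hp hip hC => ?_⟩
    have hs : SGP.SES i p := ⟨hi, hp, LinearMap.exact_iff.2 hip.symm⟩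
    exact ⟨fun hA => H B (SGP.G_ext A B C (SGP.SG_data A hA) (SGP.SG_data C hC) i p hs),
      fun hB => H A (SGP.G_ker H A B C hB hC i p hs)⟩
end

section
/- Let R be a coherent ring with Gorenstein weak dimension at most n (i.e., every R-module has Gorenstein flat dimension at most n). Then every injective R-module has flat dimension at most n. -/
universe u

open LinearMap DirectSum

open TensorProduct in
/-- `Tor₁(M, N) = 0`, via all short exact sequences ending in `N`. -/
def T1 (R : Type u) [CommRing R] (M N : Type u) [AddCommGroup M] [Module R M]
    [AddCommGroup N] [Module R N] : Prop :=
  ∀ (A B : Type u) [AddCommGroup A] [Module R A] [AddCommGroup B] [Module R B]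
    (i : A →ₗ[R] B) (p : B →ₗ[R] N), Function.Injective i → Function.Exact i p →
    Function.Surjective p → Function.Injective (i.rTensor M)

section Aux

variable {R : Type u} [CommRing R]

theorem T1.of_flat (F N : Type u) [AddCommGroup F] [Module R F] [Module.Flat R F]
    [AddCommGroup N] [Module R N] : T1 R F N := by
  intro A B _ _ _ _ i p hi _ _
  exact Module.Flat.rTensor_preserves_injective_linearMap i hi

/-- The basic diagram chase. -/
theorem T1.of_ses {K F M N : Type u} [AddCommGroup K] [Module R K] [AddCommGroup F] [Module R F]
    [AddCommGroup M] [Module R M] [AddCommGroup N] [Module R N]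
    (j : K →ₗ[R] F) (q : F →ₗ[R] M) (hjq : Function.Exact j q) (hq : Function.Surjective q)
    (hF : T1 R F N) (hinj : Function.Injective (j.lTensor N)) : T1 R M N := by
  intro A B _ _ _ _ i p hi hip hp
  rw [injective_iff_map_eq_zero]
  intro x hx
  obtain ⟨y, rfl⟩ := LinearMap.lTensor_surjective A hq x
  have comm : ∀ {A B K F : Type u} [AddCommGroup A] [Module R A] [AddCommGroup B] [Module R B]
      [AddCommGroup K] [Module R K] [AddCommGroup F] [Module R F] (i : A →ₗ[R] B)
      (j : K →ₗ[R] F) (w : TensorProduct R A K),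
      i.rTensor F (j.lTensor A w) = j.lTensor B (i.rTensor K w) := by
    intro A B K F _ _ _ _ _ _ _ _ i j w
    rw [← LinearMap.comp_apply, ← LinearMap.comp_apply, LinearMap.rTensor_comp_lTensor,
      LinearMap.lTensor_comp_rTensor]
  rw [comm] at hx
  obtain ⟨z, hz⟩ := (lTensor_exact B hjq hq _).1 hx
  have h1 : p.rTensor K z = 0 := by
    apply hinj
    rw [map_zero, ← comm, hz]
    exact (rTensor_exact F hip hp).apply_apply_eq_zero y
  obtain ⟨w, rfl⟩ := (rTensor_exact K hip hp _).1 h1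
  rw [← comm] at hz
  have := hF A B i p hi hip hp hz
  rw [← this]
  exact (lTensor_exact A hjq hq).apply_apply_eq_zero w

/-- Dimension shift. -/
theorem T1.shift {A G M N' P N : Type u} [AddCommGroup A] [Module R A] [AddCommGroup G]
    [Module R G] [AddCommGroup M] [Module R M] [AddCommGroup N] [Module R N]
    [AddCommGroup P] [Module R P] [AddCommGroup N'] [Module R N'] [Module.Flat R P]
    (j : A →ₗ[R] G) (q : G →ₗ[R] M) (hj : Function.Injective j)
    (hjq : Function.Exact j q) (hq : Function.Surjective q)
    (i : N' →ₗ[R] P) (p : P →ₗ[R] N) (hi : Function.Injective i)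
    (hip : Function.Exact i p) (hp : Function.Surjective p)
    (hA : T1 R A N) (hG : T1 R G N') : T1 R M N' := by
  refine T1.of_ses j q hjq hq hG ?_
  have h1 := hA N' P i p hi hip hp
  have h2 : Function.Injective (j.lTensor P) := Module.Flat.lTensor_preserves_injective_linearMap j hj
  have h3 : Function.Injective ((j.lTensor P) ∘ₗ (i.rTensor A)) := h2.comp h1
  rw [LinearMap.lTensor_comp_rTensor, ← LinearMap.rTensor_comp_lTensor] at h3
  exact Function.Injective.of_comp (f := i.rTensor G) h3

theorem T1.congr {M M' N : Type u} [AddCommGroup M] [Module R M] [AddCommGroup M'] [Module R M']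
    [AddCommGroup N] [Module R N] (e : M ≃ₗ[R] M') (h : T1 R M' N) : T1 R M N := by
  refine T1.of_ses (0 : PUnit.{u+1} →ₗ[R] M') e.symm.toLinearMap ?_ e.symm.surjective h
    (Function.injective_of_subsingleton _)
  intro x
  constructor
  · intro hx
    have hx0 : x = 0 := by simpa using hx
    exact ⟨0, by simp [hx0]⟩
  · rintro ⟨y, rfl⟩
    simp

/-- Free cover. -/
noncomputable def cov (N : ModuleCat.{u} R) : (N →₀ R) →ₗ[R] N :=
  Finsupp.linearCombination R (id : N → N)

theorem cov_surj (N : ModuleCat.{u} R) : Function.Surjective (cov N) :=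
  Finsupp.linearCombination_id_surjective R N

/-- Syzygy. -/
noncomputable def syz (N : ModuleCat.{u} R) : ModuleCat.{u} R :=
  ModuleCat.of R (LinearMap.ker (cov N))

theorem exact_ker {A B : Type u} [AddCommGroup A] [Module R A] [AddCommGroup B] [Module R B]
    (p : A →ₗ[R] B) : Function.Exact (LinearMap.ker p).subtype p :=
  LinearMap.exact_subtype_ker_map p

theorem T1.shift_syz {A G M : Type u} [AddCommGroup A] [Module R A] [AddCommGroup G]
    [Module R G] [AddCommGroup M] [Module R M] (N : ModuleCat.{u} R)
    (j : A →ₗ[R] G) (q : G →ₗ[R] M) (hj : Function.Injective j)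
    (hjq : Function.Exact j q) (hq : Function.Surjective q)
    (hA : T1 R A N) (hG : T1 R G (syz N)) : T1 R M (syz N) :=
  T1.shift (N' := LinearMap.ker (cov N)) j q hj hjq hq (LinearMap.ker (cov N)).subtype (cov N)
    (Submodule.subtype_injective _) (exact_ker _) (cov_surj N) hA hG

theorem flat_of_T1 (N : ModuleCat.{u} R) (h : ∀ M : ModuleCat.{u} R, T1 R M N) :
    Module.Flat R N := by
  rw [Module.Flat.iff_rTensor_preserves_injective_linearMap]
  intro A B _ _ _ _ i hi
  have h1 : T1 R N (B ⧸ LinearMap.range i) :=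
    T1.of_ses (K := LinearMap.ker (cov N)) (LinearMap.ker (cov N)).subtype (cov N)
      (exact_ker (cov N)) (cov_surj N)
      (T1.of_flat _ _) (by
        have := h (ModuleCat.of R (B ⧸ LinearMap.range i)) (LinearMap.ker (cov N)) _
          (LinearMap.ker (cov N)).subtype
          (cov N) (Submodule.subtype_injective _) (exact_ker (cov N)) (cov_surj N)
        exact (LinearMap.lTensor_inj_iff_rTensor_inj _ _).2 this)
  exact h1 A B i (LinearMap.range i).mkQ hi (LinearMap.exact_map_mkQ_range i)
    (Submodule.mkQ_surjective _)

theorem flatDim_of_syz (n : ℕ) : ∀ N : ModuleCat.{u} R, Module.Flat R (syz^[n] N) →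
    FlatDimLE R n N := by
  induction n with
  | zero => intro N h; exact h
  | succ n ih =>
    intro N h
    exact ⟨ModuleCat.of R (N →₀ R), cov N, inferInstanceAs (Module.Flat R (N →₀ R)),
      cov_surj N, ih (syz N) h⟩

theorem range_T1 (I : ModuleCat.{u} R) (F : ℤ → ModuleCat.{u} R)
    (d : ∀ i : ℤ, F (i + 1) →ₗ[R] F i)
    (hF : ∀ i, Module.Flat R (F i))
    (hd : ∀ i, LinearMap.ker (d i) = LinearMap.range (d (i + 1)))
    (hI : ∀ i : ℤ, LinearMap.ker (LinearMap.rTensor I (d i)) =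
        LinearMap.range (LinearMap.rTensor I (d (i + 1)))) (k : ℕ) :
    ∀ i, T1 R (LinearMap.range (d i)) (syz^[k] I) := by
  have ex : ∀ i, Function.Exact (LinearMap.range (d (i+1))).subtype (d i).rangeRestrict := by
    intro i x
    rw [← hd]
    simp [Subtype.ext_iff]
  induction k with
  | zero =>
    intro i
    have := hF (i+1)
    refine T1.of_ses (LinearMap.range (d (i+1))).subtype (d i).rangeRestrict (ex i)
      (LinearMap.surjective_rangeRestrict _) (T1.of_flat _ _) ?_
    refine (LinearMap.lTensor_inj_iff_rTensor_inj _ _).2 ?_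
    change Function.Injective ((LinearMap.range (d (i+1))).subtype.rTensor I)
    rw [injective_iff_map_eq_zero]
    intro x hx
    obtain ⟨y, rfl⟩ := LinearMap.rTensor_surjective (R := R) I
      (g := (d (i+1)).rangeRestrict) (LinearMap.surjective_rangeRestrict (d (i+1))) x
    have hy : y ∈ LinearMap.ker (LinearMap.rTensor I (d (i+1))) := by
      rw [LinearMap.mem_ker, ← hx]
      erw [← LinearMap.comp_apply, ← LinearMap.rTensor_comp]
      rfl
    rw [hI] at hy
    obtain ⟨z, rfl⟩ := hy
    erw [← LinearMap.comp_apply, ← LinearMap.rTensor_comp]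
    have : (d (i+1)).rangeRestrict ∘ₗ d (i+1+1) = 0 := by
      ext x
      have : d (i+1+1) x ∈ LinearMap.ker (d (i+1)) := by rw [hd]; exact ⟨x, rfl⟩
      simpa using this
    rw [this]; simp
  | succ k ih =>
    intro i
    rw [Function.iterate_succ_apply']
    have := hF (i+1)
    exact T1.shift_syz _ (LinearMap.range (d (i+1))).subtype (d i).rangeRestrict
      (Submodule.subtype_injective _) (ex i)
      (LinearMap.surjective_rangeRestrict _) (ih (i+1)) (T1.of_flat _ _)

theorem gflat_T1 (I : ModuleCat.{u} R) (hI : Module.Injective R I) (k : ℕ)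
    (M : ModuleCat.{u} R) (hM : IsGFlat R M) : T1 R M (syz^[k] I) := by
  obtain ⟨F, d, hF, -, hd, ⟨e⟩, hT⟩ := hM
  exact T1.congr e (range_T1 I F d hF hd (hT I hI) k 0)

theorem gfd_T1 (I : ModuleCat.{u} R) (hI : Module.Injective R I) (n : ℕ) :
    ∀ M : ModuleCat.{u} R, GfdLE R n M → T1 R M (syz^[n] I) := by
  induction n with
  | zero => intro M hM; exact gflat_T1 I hI 0 M hM
  | succ n ih =>
    rintro M ⟨G, p, hG, hp, hK⟩
    have h1 := gflat_T1 I hI (n+1) G hG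
    rw [Function.iterate_succ_apply'] at h1 ⊢
    have h2 : T1 R (LinearMap.ker p) (syz^[n] I) := ih (ModuleCat.of R (LinearMap.ker p)) hK
    exact T1.shift_syz (syz^[n] I) (LinearMap.ker p).subtype p (Submodule.subtype_injective _)
      (exact_ker p) hp h2 h1

end Aux

/-- If `R` is coherent and every `R`-module has Gorenstein flat dimension at
most `n`, then every injective `R`-module has flat dimension at most `n`. -/
theorem stmt6 (R : Type u) [CommRing R] (hcoh : IsCoherent R) (n : ℕ)
    (h : ∀ M : ModuleCat.{u} R, GfdLE R n M) :
    ∀ I : ModuleCat.{u} R, Module.Injective R I → FlatDimLE R n I := by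
  intro I hI
  exact flatDim_of_syz n I (flat_of_T1 _ fun M => gfd_T1 I hI n M (h M))
end

section
/- Let R be a ring with G-gldim(R) ≤ 1 such that the class of strongly Gorenstein projective R-modules is projectively resolving. Then R is coherent. -/
universe u

open LinearMap DirectSum

/-- A convenient criterion: an injection with the right range replaces the isomorphism. -/
theorem isSGProjective_of_inj {R : Type u} [CommRing R] {M P : Type u} [AddCommGroup M]
    [Module R M] [AddCommGroup P] [Module R P] [Module.Projective R P] (f : P →ₗ[R] P)
    (hf : ∀ x, f x = 0 ↔ ∃ y, f y = x) (j : M →ₗ[R] P) (hj : Function.Injective j)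
    (hr : LinearMap.range j = LinearMap.range f)
    (hQ : ∀ Q : ModuleCat.{u} R, Module.Projective R Q →
        ∀ g : P →ₗ[R] Q, g ∘ₗ f = 0 → ∃ h : P →ₗ[R] Q, g = h ∘ₗ f) :
    IsSGProjective R M := by
  refine ⟨ModuleCat.of R P, ‹_›, f, ?_, ?_, ⟨?_⟩, hQ⟩
  · ext x
    exact (hf (f x)).2 ⟨x, rfl⟩
  · ext x
    simpa using hf x
  · exact (LinearEquiv.ofInjective j hj).trans (LinearEquiv.ofEq _ _ hr)

/-- Countable copowers of strongly Gorenstein projectives. -/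
theorem isSGProjective_finsupp {R : Type u} [CommRing R] {M : Type u} [AddCommGroup M]
    [Module R M] (h : IsSGProjective R M) : IsSGProjective R (ℕ →₀ M) := by
  obtain ⟨P, hP, f, hff, hker, ⟨e⟩, hQ⟩ := h
  have hff' : ∀ x, f (f x) = 0 := fun x => LinearMap.congr_fun hff x
  let j : M →ₗ[R] P := (LinearMap.range f).subtype ∘ₗ e.toLinearMap
  have hj : Function.Injective j := (Subtype.val_injective).comp e.injective
  have hlift : ∀ (x : ℕ →₀ P) (N : Type u) [AddCommGroup N] [Module R N] (k : N →ₗ[R] P),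
      (∀ n, ∃ y, k y = x n) → ∃ y : ℕ →₀ N, Finsupp.mapRange.linearMap k y = x := by
    intro x N _ _ k hx
    have : ∀ n, ∃ y, k y = x n ∧ (x n = 0 → y = 0) := by
      intro n
      by_cases h0 : x n = 0
      · exact ⟨0, by simp [h0], fun _ => rfl⟩
      · obtain ⟨y, hy⟩ := hx n
        exact ⟨y, hy, fun h => absurd h h0⟩
    choose y hy hy0 using this
    refine ⟨Finsupp.onFinset x.support y ?_, ?_⟩
    · intro n hn
      rw [Finsupp.mem_support_iff]
      exact fun h => hn (hy0 n h)
    · ext n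
      simp [hy]
  have hPN : Module.Projective R (ℕ →₀ P) := by
    classical
    exact Module.Projective.of_equiv (finsuppLequivDFinsupp (ι := ℕ) (M := P) R).symm
  refine isSGProjective_of_inj (P := ℕ →₀ P) (Finsupp.mapRange.linearMap f) ?_
    (Finsupp.mapRange.linearMap j) ?_ ?_ ?_
  · intro x
    constructor
    · intro hx
      apply hlift
      intro n
      have : f (x n) = 0 := by simpa using DFunLike.congr_fun hx n
      have h2 : x n ∈ LinearMap.ker f := this
      rw [hker] at h2
      exact h2
    · rintro ⟨y, rfl⟩
      ext n
      simp [hff']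
  · exact Finsupp.mapRange_injective j (map_zero j) hj
  · apply le_antisymm
    · rintro _ ⟨y, rfl⟩
      apply hlift
      intro n
      exact (e (y n)).2
    · rintro _ ⟨y, rfl⟩
      apply hlift
      intro n
      refine ⟨e.symm ⟨f (y n), y n, rfl⟩, ?_⟩
      simp [j]
  · intro Q hQp g hg
    have : ∀ n, ∃ h : P →ₗ[R] Q, g ∘ₗ Finsupp.lsingle n = h ∘ₗ f := by
      intro n
      apply hQ Q hQp
      ext p
      have := LinearMap.congr_fun hg (Finsupp.single n p)
      simpa using this
    choose h hh using this
    refine ⟨Finsupp.lsum ℕ h, ?_⟩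
    ext n p
    have := LinearMap.congr_fun (hh n) p
    simpa using this

/-- If strongly Gorenstein projectives are resolving, they are closed under retracts. -/
theorem isSGProjective_retract {R : Type u} [CommRing R]
    (h2 : ProjResolving R (fun N : ModuleCat.{u} R => IsSGProjective R N))
    {M N : Type u} [AddCommGroup M] [Module R M] [AddCommGroup N] [Module R N]
    (hN : IsSGProjective R N) (s : M →ₗ[R] N) (r : N →ₗ[R] M) (hrs : ∀ m, r (s m) = m) :
    IsSGProjective R M := by
  have hX := isSGProjective_finsupp hN
  let sh : (ℕ →₀ N) →ₗ[R] (ℕ →₀ N) :=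
    Finsupp.lcomapDomain Nat.succ Nat.succ_injective
  let up : (ℕ →₀ N) →ₗ[R] (ℕ →₀ N) := Finsupp.lmapDomain N R Nat.succ
  let e : N →ₗ[R] N := s ∘ₗ r
  let E : (ℕ →₀ N) →ₗ[R] (ℕ →₀ N) := Finsupp.mapRange.linearMap e
  let p : (ℕ →₀ N) →ₗ[R] (ℕ →₀ N) := LinearMap.id - E + E ∘ₗ sh
  have hp : ∀ x n, p x n = x n - s (r (x n)) + s (r (x (n + 1))) := by
    intro x n
    simp [p, E, e, sh, Finsupp.lcomapDomain]
  have hup0 : ∀ x, up x 0 = 0 := by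
    intro x
    exact Finsupp.mapDomain_of_notMem_range _ _ (by simp)
  have hups : ∀ x n, up x (n + 1) = x n := by
    intro x n
    exact Finsupp.mapDomain_apply Nat.succ_injective x n
  let i : M →ₗ[R] (ℕ →₀ N) := Finsupp.lsingle 0 ∘ₗ s
  refine (h2.2 (ModuleCat.of R M) (ModuleCat.of R (ℕ →₀ N)) (ModuleCat.of R (ℕ →₀ N))
    i p ?_ ?_ ?_ hX).2 hX
  · intro a b hab
    have h := DFunLike.congr_fun hab 0
    have h' : s a = s b := by simpa [i] using h
    rw [← hrs a, ← hrs b, h']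
  · intro y
    refine ⟨y - E y + E (up y), ?_⟩
    ext n
    rw [hp]
    have hE : ∀ (x : ℕ →₀ N) n, E x n = s (r (x n)) := fun x n => by simp [E, e]
    simp [hE, hrs, hups]
  · ext x
    constructor
    · rintro ⟨m, rfl⟩
      change p (i m) = 0
      ext n
      rw [hp]
      rcases n with _ | n <;> simp [i, hrs]
    · intro hx
      have hx' : ∀ n, x n - s (r (x n)) + s (r (x (n + 1))) = 0 := by
        intro n
        rw [← hp, show p x = 0 from hx]
        rfl
      have h3 : ∀ n, r (x (n + 1)) = 0 := by
        intro n
        have := congrArg r (hx' n)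
        simpa [hrs] using this
      have h4 : ∀ n, x n = s (r (x n)) := by
        intro n
        have := hx' n
        rw [h3, map_zero, add_zero] at this
        exact sub_eq_zero.1 this
      refine ⟨r (x 0), ?_⟩
      change i (r (x 0)) = x
      ext n
      rcases n with _ | n
      · simp [i, ← h4]
      · rw [h4 (n + 1), h3]
        simp [i]

/-- A Gorenstein projective is a retract of a strongly Gorenstein projective. -/
theorem IsGProjective.exists_retract {R : Type u} [CommRing R] {M : Type u} [AddCommGroup M]
    [Module R M] (h : IsGProjective R M) :
    ∃ (N : ModuleCat.{u} R) (s : M →ₗ[R] N) (r : N →ₗ[R] M), IsSGProjective R N ∧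
      ∀ m, r (s m) = m := by
  classical
  obtain ⟨P, d, hP, hdd, hker, ⟨e⟩, hQ⟩ := h
  have hdd' : ∀ i x, d i (d (i + 1) x) = 0 := fun i x => LinearMap.congr_fun (hdd i) x
  have hinj : Function.Injective (fun i : ℤ => i + 1) := add_left_injective 1
  let f : (Π₀ i, P i) →ₗ[R] (Π₀ i, P i) :=
    { toFun := fun x => DFinsupp.mapRange (fun i => d i) (fun i => map_zero (d i))
        (DFinsupp.comapDomain (fun i : ℤ => i + 1) hinj x)
      map_add' := by
        intro x y
        ext i
        simp
      map_smul' := by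
        intro c x
        ext i
        simp }
  have hf : ∀ x i, f x i = d i (x (i + 1)) := fun x i => by simp [f]
  have hfs : ∀ i (p : P (i + 1)), f (DFinsupp.single (i + 1) p) = DFinsupp.single i (d i p) := by
    intro i p
    ext j
    rw [hf]
    by_cases hij : i = j
    · subst hij
      simp
    · have h' : i + 1 ≠ j + 1 := fun h => hij (by omega)
      simp only [DFinsupp.single_apply, dif_neg hij, dif_neg h', map_zero]
  have hlift : ∀ x : Π₀ i, P i, (∀ i, ∃ y, d i y = x i) → ∃ z, f z = x := by
    intro x hx
    have : ∀ i, ∃ v : P i, (∀ k (h : k + 1 = i), d k (h ▸ v) = x k) ∧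
        (∀ k, k + 1 = i → x k = 0 → v = 0) := by
      intro i
      obtain ⟨k, rfl⟩ : ∃ k, i = k + 1 := ⟨i - 1, by ring⟩
      by_cases h0 : x k = 0
      · refine ⟨0, ?_, fun _ _ _ => rfl⟩
        intro k' h
        obtain rfl : k' = k := by omega
        simp [h0]
      · obtain ⟨y, hy⟩ := hx k
        refine ⟨y, ?_, ?_⟩
        · intro k' h
          obtain rfl : k' = k := by omega
          exact hy
        · intro k' h h'
          obtain rfl : k' = k := by omega
          exact absurd h' h0
    choose z hz hz0 using this
    refine ⟨DFinsupp.mk (x.support.image (fun i => i + 1)) (fun i => z i), ?_⟩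
    ext i
    rw [hf, DFinsupp.mk_apply]
    split_ifs with h
    · exact hz (i + 1) i rfl
    · have : x i = 0 := by
        by_contra hne
        exact h (Finset.mem_image.2 ⟨i, by simpa using hne, rfl⟩)
      rw [this, map_zero]
  refine ⟨ModuleCat.of R (LinearMap.range f), ?_, ?_, ?_, ?_⟩
  · refine LinearMap.codRestrict _ (DFinsupp.lsingle 0 ∘ₗ (LinearMap.range (d 0)).subtype ∘ₗ
      e.toLinearMap) ?_
    intro m
    obtain ⟨y, hy⟩ := (e m).2
    exact ⟨DFinsupp.single (0 + 1) y, by rw [hfs]; simp [hy]⟩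
  · refine e.symm.toLinearMap ∘ₗ LinearMap.codRestrict _
      (DFinsupp.lapply 0 ∘ₗ (LinearMap.range f).subtype) ?_
    rintro ⟨_, y, rfl⟩
    exact ⟨y (0 + 1), (hf y 0).symm⟩
  · refine isSGProjective_of_inj (P := Π₀ i, P i) f ?_ (LinearMap.range f).subtype
      Subtype.val_injective (Submodule.range_subtype _) ?_
    · intro x
      constructor
      · intro hx
        apply hlift
        intro i
        obtain ⟨k, rfl⟩ : ∃ k, i = k + 1 := ⟨i - 1, by ring⟩
        have h1 : x (k + 1) ∈ LinearMap.ker (d k) := by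
          rw [LinearMap.mem_ker, ← hf, hx]
          rfl
        rw [hker] at h1
        exact h1
      · rintro ⟨y, rfl⟩
        ext i
        rw [hf, hf, hdd']
        rfl
    · intro Q hQp g hg
      have : ∀ i, ∃ h : P i →ₗ[R] Q, g ∘ₗ DFinsupp.lsingle (i + 1) = h ∘ₗ d i := by
        intro i
        apply hQ Q hQp
        ext p
        have := LinearMap.congr_fun hg (DFinsupp.single (i + 1 + 1) p)
        rw [LinearMap.comp_apply, hfs] at this
        simpa using this
      choose h hh using this
      refine ⟨DFinsupp.lsum ℕ h, ?_⟩
      apply DFinsupp.lhom_ext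
      intro i p
      obtain ⟨k, rfl⟩ : ∃ k, i = k + 1 := ⟨i - 1, by ring⟩
      have := LinearMap.congr_fun (hh k) p
      rw [LinearMap.comp_apply, hfs]
      simpa using this
  · intro m
    apply e.injective
    ext
    simp

theorem isSGProjective_of_G {R : Type u} [CommRing R]
    (h2 : ProjResolving R (fun N : ModuleCat.{u} R => IsSGProjective R N))
    {M : Type u} [AddCommGroup M] [Module R M] (h : IsGProjective R M) :
    IsSGProjective R M := by
  obtain ⟨N, s, r, hN, hrs⟩ := h.exists_retract
  exact isSGProjective_retract h2 hN s r hrs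

/-- Finitely generated strongly Gorenstein projectives are finitely presented. -/
theorem IsSGProjective.finitePresentation {R : Type u} [CommRing R] {M : Type u}
    [AddCommGroup M] [Module R M] (h : IsSGProjective R M) [Module.Finite R M] :
    Module.FinitePresentation R M := by
  obtain ⟨P, hP, f, -, hker, ⟨e⟩, -⟩ := h
  have hr : Module.Finite R (LinearMap.range f) := Module.Finite.equiv e
  have hrfg : (LinearMap.range f).FG := Module.Finite.iff_fg.1 hr
  have hPf : Module.Finite R P := by
    refine ⟨Submodule.fg_of_fg_map_of_fg_inf_ker f ?_ ?_⟩
    · rwa [Submodule.map_top]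
    · rwa [top_inf_eq, hker]
  have hPp : Module.FinitePresentation R P := Module.finitePresentation_of_projective R P
  have := Module.finitePresentation_of_surjective f.rangeRestrict f.surjective_rangeRestrict
    (by rwa [LinearMap.ker_rangeRestrict, hker])
  exact Module.finitePresentation_of_surjective e.symm.toLinearMap e.symm.surjective
    (by rw [LinearEquiv.ker]; exact Submodule.fg_bot)

/-- If `G-gldim(R) ≤ 1` and the class of strongly Gorenstein projective
`R`-modules is projectively resolving, then `R` is coherent. -/
theorem stmt7 (R : Type u) [CommRing R]
    (h1 : ∀ M : ModuleCat.{u} R, GpdLE R 1 M)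
    (h2 : ProjResolving R (fun N : ModuleCat.{u} R => IsSGProjective R N)) :
    IsCoherent R := by
  intro I hI
  obtain ⟨G, p, hG, hp, hK⟩ := h1 (ModuleCat.of R (R ⧸ I))
  have hG' := isSGProjective_of_G h2 hG
  have hK' : IsSGProjective R (LinearMap.ker p) := isSGProjective_of_G h2 hK
  have hR : IsSGProjective R R := h2.1 (ModuleCat.of R R) (inferInstanceAs (Module.Projective R R))
  let q : R →ₗ[R] (R ⧸ I) := Submodule.mkQ I
  let p' : G →ₗ[R] (R ⧸ I) := p
  let E : Submodule R (R × G) :=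
    LinearMap.eqLocus (q ∘ₗ LinearMap.fst R R G) (p' ∘ₗ LinearMap.snd R R G)
  have hE : ∀ x : R × G, x ∈ E ↔ q x.1 = p' x.2 := fun x => Iff.rfl
  have hq : ∀ x, q x = 0 ↔ x ∈ I := fun x => Submodule.Quotient.mk_eq_zero I
  have hES : IsSGProjective R E := by
    refine (h2.2 (ModuleCat.of R (LinearMap.ker p)) (ModuleCat.of R E) (ModuleCat.of R R)
      (LinearMap.codRestrict E (LinearMap.inr R R G ∘ₗ (LinearMap.ker p).subtype) ?_)
      (LinearMap.fst R R G ∘ₗ E.subtype) ?_ ?_ ?_ hR).1 hK'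
    · rintro ⟨x, hx⟩
      rw [hE]
      change q 0 = p x
      rw [map_zero, LinearMap.mem_ker.1 hx]
    · intro a b hab
      have := congrArg (fun z : E => (z : R × G).2) hab
      exact Subtype.ext this
    · intro x
      obtain ⟨g, hg⟩ := hp (q x)
      exact ⟨⟨(x, g), hg.symm⟩, rfl⟩
    · ext x
      constructor
      · rintro ⟨y, rfl⟩
        rfl
      · obtain ⟨⟨a, g⟩, hx⟩ := x
        intro h0
        have h0' : a = 0 := h0
        subst h0'
        have hg : p g = 0 := by
          have := (hE _).1 hx
          exact this.symm.trans (map_zero q)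
        exact ⟨⟨g, hg⟩, rfl⟩
  have hIS : IsSGProjective R I := by
    refine (h2.2 (ModuleCat.of R I) (ModuleCat.of R E) G
      (LinearMap.codRestrict E (LinearMap.inl R R G ∘ₗ I.subtype) ?_)
      (LinearMap.snd R R G ∘ₗ E.subtype) ?_ ?_ ?_ hG').2 hES
    · rintro ⟨x, hx⟩
      rw [hE]
      change q x = p' 0
      rw [map_zero, (hq x).2 hx]
    · intro a b hab
      have := congrArg (fun z : E => (z : R × G).1) hab
      exact Subtype.ext this
    · intro g
      obtain ⟨x, hx⟩ := Submodule.mkQ_surjective I (p' g)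
      exact ⟨⟨(x, g), hx⟩, rfl⟩
    · ext x
      constructor
      · rintro ⟨y, rfl⟩
        rfl
      · obtain ⟨⟨a, g⟩, hx⟩ := x
        intro h0
        have h0' : g = 0 := h0
        subst h0'
        have ha : a ∈ I := by
          rw [← hq]
          have := (hE _).1 hx
          exact this.trans (map_zero p')
        exact ⟨⟨a, ha⟩, rfl⟩
  have : Module.Finite R I := Module.Finite.iff_fg.2 hI
  exact hIS.finitePresentation
end

section
/- Let R be a commutative ring with finite weak global dimension. Then every Gorenstein projective R-module is projective, and hence the class of strongly Gorenstein projective R-modules equals the class of projective modules and is projectively resolving. -/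
universe u

open LinearMap DirectSum

theorem flat_ker {R : Type*} [CommRing R] {B C : Type*} [AddCommGroup B] [Module R B]
    [AddCommGroup C] [Module R C] [Module.Flat R B] [Module.Flat R C] (p : B →ₗ[R] C)
    (hp : Function.Surjective p) : Module.Flat R (LinearMap.ker p) := by
  rw [Module.Flat.iff_forall_exists_factorization]
  intro l f x hx
  obtain ⟨k, a, y, hy, ha⟩ := Module.Flat.exists_factorization_of_apply_eq_zero_of_free
    (f := f) (x := (LinearMap.ker p).subtype ∘ₗ x) (by simp [hx])
  obtain ⟨m, a', y', hy', ha'⟩ := Module.Flat.exists_factorization_of_comp_eq_zero_of_free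
    (f := a) (x := p ∘ₗ y) (by
      rw [LinearMap.comp_assoc, ← hy]; ext; simp)
  obtain ⟨z, hz⟩ := Module.projective_lifting_property p y' hp
  refine ⟨k, a, LinearMap.codRestrict _ (y - z ∘ₗ a') ?_, ?_, ha⟩
  · intro c
    have h1 := LinearMap.congr_fun hy' c
    have h2 := LinearMap.congr_fun hz (a' c)
    simp only [LinearMap.comp_apply] at h1 h2
    simp [LinearMap.mem_ker, h1, h2]
  · refine LinearMap.ext fun c => Subtype.ext ?_
    have h1 := LinearMap.congr_fun hy c
    have h2 := LinearMap.congr_fun ha' c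
    simp only [LinearMap.comp_apply, Submodule.subtype_apply, LinearMap.zero_apply] at h1 h2
    simp [h1, h2]


theorem flat_prod {R : Type*} [CommRing R] {B C : Type*} [AddCommGroup B] [Module R B]
    [AddCommGroup C] [Module R C] [Module.Flat R B] [Module.Flat R C] :
    Module.Flat R (B × C) := by
  rw [Module.Flat.iff_forall_exists_factorization]
  intro l f x hx
  obtain ⟨k, a, y, hy, ha⟩ := Module.Flat.exists_factorization_of_apply_eq_zero_of_free
    (f := f) (x := LinearMap.fst R B C ∘ₗ x) (by simp [hx])
  obtain ⟨k', a', y', hy', ha'⟩ := Module.Flat.exists_factorization_of_apply_eq_zero_of_free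
    (f := f) (x := LinearMap.snd R B C ∘ₗ x) (by simp [hx])
  let e : ((Fin k →₀ R) × (Fin k' →₀ R)) ≃ₗ[R] (Fin (k + k') →₀ R) :=
    (Finsupp.sumFinsuppLEquivProdFinsupp R).symm ≪≫ₗ Finsupp.domLCongr finSumFinEquiv
  refine ⟨k + k', e.toLinearMap ∘ₗ (a.prod a'), (y.prodMap y') ∘ₗ e.symm.toLinearMap, ?_, ?_⟩
  · refine LinearMap.ext fun c => ?_
    have h1 := LinearMap.congr_fun hy c
    have h2 := LinearMap.congr_fun hy' c
    simp only [LinearMap.comp_apply, LinearMap.fst_apply, LinearMap.snd_apply] at h1 h2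
    ext <;> simp [h1, h2]
  · simp [ha, ha']

section Core

variable {R F I : Type*} [CommRing R] [AddCommGroup F] [Module R F]

/-- Local contractibility: every finite set of cycles is fixed by some `f σ`, `σ` of
finite rank. -/
def LocContr (f : F →ₗ[R] F) : Prop :=
  ∀ S : Finset F, (∀ x ∈ S, f x = 0) →
    ∃ (σ : F →ₗ[R] F) (N : Submodule R F), N.FG ∧ (∀ x, σ x ∈ N) ∧ ∀ x ∈ S, f (σ x) = x

theorem LocContr.fg {f : F →ₗ[R] F} (H : LocContr f) (hf : ∀ x, f (f x) = 0)
    (N : Submodule R F) (hN : N.FG) :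
    ∃ (τ : F →ₗ[R] F) (L : Submodule R F), L.FG ∧ (∀ x, τ x ∈ L) ∧ ∀ x ∈ N, f x = 0 → f (τ x) = x := by
  classical
  obtain ⟨S, rfl⟩ := hN
  obtain ⟨σ, -, -, -, hσ⟩ := H (S.image f) (by simp [hf])
  obtain ⟨σ', L, hfg, hL, hσ'⟩ := H (S.image (fun x => x - σ (f x))) (by
    intro x hx
    obtain ⟨y, hy, rfl⟩ := Finset.mem_image.1 hx
    rw [map_sub, hσ _ (Finset.mem_image_of_mem _ hy), sub_self])
  refine ⟨σ' ∘ₗ (LinearMap.id - σ ∘ₗ f), L, hfg, fun x => hL _, ?_⟩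
  · intro x hx h0
    have h1 : Set.EqOn (f ∘ₗ σ' ∘ₗ (LinearMap.id - σ ∘ₗ f) : F →ₗ[R] F)
        (LinearMap.id - σ ∘ₗ f : F →ₗ[R] F)
        (Submodule.span R (S : Set F)) := by
      apply LinearMap.eqOn_span
      intro y hy
      exact hσ' _ (Finset.mem_image_of_mem _ hy)
    have := h1 hx
    simpa [h0] using this

/-- The countable telescope. -/
theorem telescope (f : F →ₗ[R] F) (hf : ∀ x, f (f x) = 0) (G : ℕ → Submodule R F)
    (hG : Monotone G) (τ : ℕ → F →ₗ[R] F) (h1 : ∀ n x, τ n x ∈ G (n + 1))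
    (h2 : ∀ n x, f (τ n x) ∈ G (n + 1)) (h3 : ∀ n, ∀ x ∈ G n, f x = 0 → f (τ n x) = x)
    (h4 : ∀ n, ∀ x ∈ G n, f x ∈ G (n + 1)) :
    ∃ T : ℕ → F →ₗ[R] F, ∀ n, ∀ x ∈ G n, ∀ m, n + 3 ≤ m →
      T m x = T (n + 3) x ∧ T m x ∈ G (n + 5) ∧ f (T m x) + T m (f x) = x := by
  let S : ℕ → F →ₗ[R] F := fun n => Nat.rec (τ 1 ∘ₗ f ∘ₗ τ 0)
    (fun k s => s + τ (k + 2) ∘ₗ (f ∘ₗ τ (k + 1) - f ∘ₗ τ k)) n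
  have S0 : ∀ x, S 0 x = τ 1 (f (τ 0 x)) := fun x => rfl
  have Ss : ∀ n x, S (n + 1) x = S n x + τ (n + 2) (f (τ (n + 1) x) - f (τ n x)) :=
    fun n x => rfl
  have hfS : ∀ n x, f (S n x) = f (τ n x) := by
    intro n x
    induction n with
    | zero => rw [S0, h3 1 _ (h2 0 x) (hf _)]
    | succ k ih =>
      rw [Ss, map_add, ih, h3 (k + 2) _ _ (by simp [hf])]
      · abel
      · exact sub_mem (h2 _ _) (hG (by omega) (h2 k x))
  have hSG : ∀ n x, S n x ∈ G (n + 2) := by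
    intro n x
    induction n with
    | zero => exact h1 1 _
    | succ k ih => rw [Ss]; exact add_mem (hG (by omega) ih) (h1 _ _)
  have hSst : ∀ n, ∀ x ∈ G n, f x = 0 → ∀ m, n ≤ m → S m x = S n x := by
    intro n x hx h0 m hm
    induction m, hm using Nat.le_induction with
    | base => rfl
    | succ k hk ih =>
      rw [Ss, ih, h3 k x (hG hk hx) h0, h3 (k + 1) x (hG (by omega) hx) h0]; simp
  have hS : ∀ n, ∀ x ∈ G n, f x = 0 → ∀ m, n ≤ m → f (S m x) = x := by
    intro n x hx h0 m hm
    rw [hfS, h3 m x (hG hm hx) h0]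
  refine ⟨fun m => S m ∘ₗ (LinearMap.id - S m ∘ₗ f), ?_⟩
  intro n x hx m hm
  simp only [LinearMap.comp_apply, LinearMap.sub_apply, LinearMap.id_apply]
  have e1 : ∀ m, n + 1 ≤ m → S m (f x) = S (n + 1) (f x) :=
    hSst (n + 1) (f x) (h4 n x hx) (hf x)
  have hy : x - S (n + 1) (f x) ∈ G (n + 3) :=
    sub_mem (hG (by omega) hx) (hSG _ _)
  have hy0 : f (x - S (n + 1) (f x)) = 0 := by
    rw [map_sub, hS (n + 1) (f x) (h4 n x hx) (hf x) _ le_rfl, sub_self]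
  rw [e1 m (by omega), e1 (n + 3) (by omega), hSst (n + 3) _ hy hy0 m hm]
  refine ⟨rfl, hSG _ _, ?_⟩
  rw [hS (n + 3) _ hy hy0 _ le_rfl, hf, map_zero, sub_zero, e1 m (by omega)]
  abel

/-- Good partial contractions: `h` is a contraction on the subcomplex spanned by `J`. -/
def GoodPair (b : Module.Basis I R F) (f : F →ₗ[R] F) (p : Set I × (F →ₗ[R] F)) : Prop :=
  (∀ j ∈ p.1, f (b j) ∈ Submodule.span R (b '' p.1)) ∧
  (∀ j ∈ p.1, p.2 (b j) ∈ Submodule.span R (b '' p.1)) ∧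
  (∀ j ∈ p.1, f (p.2 (b j)) + p.2 (f (b j)) = b j) ∧
  (∀ j, j ∉ p.1 → p.2 (b j) = 0)

theorem span_maps (b : Module.Basis I R F) (J : Set I) (g : F →ₗ[R] F) (N : Submodule R F)
    (h : ∀ j ∈ J, g (b j) ∈ N) : ∀ x ∈ Submodule.span R (b '' J), g x ∈ N := by
  have : Submodule.span R (b '' J) ≤ N.comap g := by
    rw [Submodule.span_le]
    rintro _ ⟨j, hj, rfl⟩
    exact h j hj
  exact this

theorem all_maps (b : Module.Basis I R F) (g : F →ₗ[R] F) (N : Submodule R F)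
    (h : ∀ j, g (b j) ∈ N) : ∀ x, g x ∈ N := by
  intro x
  refine span_maps b Set.univ g N (fun j _ => h j) x ?_
  rw [Set.image_univ, b.span_eq]; trivial

theorem span_eqOn (b : Module.Basis I R F) (J : Set I) (g g' : F →ₗ[R] F)
    (h : ∀ j ∈ J, g (b j) = g' (b j)) : ∀ x ∈ Submodule.span R (b '' J), g x = g' x := by
  intro x hx
  refine LinearMap.eqOn_span (f := g) (g := g') ?_ hx
  rintro _ ⟨j, hj, rfl⟩
  exact h j hj

/-- A finitely generated submodule of the image of `q` lies in the image of a finite part. -/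
theorem fg_le_map (b : Module.Basis I R F) (q : F →ₗ[R] F) (N : Submodule R F) (hN : N.FG)
    (hq : N ≤ LinearMap.range q) :
    ∃ K : Finset I, N ≤ (Submodule.span R (b '' (K : Set I))).map q := by
  classical
  obtain ⟨S, rfl⟩ := hN
  have : ∀ x : F, ∃ K : Finset I, x ∈ S → x ∈ (Submodule.span R (b '' (K : Set I))).map q := by
    intro x
    by_cases hx : x ∈ S
    · obtain ⟨y, rfl⟩ := hq (Submodule.subset_span hx)
      exact ⟨(b.repr y).support, fun _ => ⟨y, b.mem_span_image.2 subset_rfl, rfl⟩⟩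
    · exact ⟨∅, fun h => absurd h hx⟩
  choose K hK using this
  refine ⟨S.biUnion K, Submodule.span_le.2 fun x hx => ?_⟩
  refine Submodule.map_mono (Submodule.span_mono (Set.image_mono ?_)) (hK x hx)
  exact_mod_cast Finset.subset_biUnion_of_mem K hx

theorem good_step (b : Module.Basis I R F) (f : F →ₗ[R] F) (hf : ∀ x, f (f x) = 0)
    (H : LocContr f) (J : Set I) (h : F →ₗ[R] F) (hg : GoodPair b f (J, h)) (i0 : I) :
    ∃ (J' : Set I) (h' : F →ₗ[R] F), GoodPair b f (J', h') ∧ J ⊆ J' ∧ i0 ∈ J' ∧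
      ∀ j ∈ J, h' (b j) = h (b j) := by
  classical
  obtain ⟨g1, g2, g3, g4⟩ := hg
  simp only at g1 g2 g3 g4
  have hJ : ∀ x, h x ∈ Submodule.span R (b '' J) := by
    apply all_maps
    intro j
    by_cases hj : j ∈ J
    · exact g2 j hj
    · rw [g4 j hj]; exact zero_mem _
  have fJ := span_maps b J f _ g1
  let r : F →ₗ[R] F := f ∘ₗ h + h ∘ₗ f
  have hr : ∀ x, r x = f (h x) + h (f x) := fun x => rfl
  have rJ : ∀ x, r x ∈ Submodule.span R (b '' J) := fun x =>
    add_mem (fJ _ (hJ x)) (hJ _)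
  have rid : ∀ x ∈ Submodule.span R (b '' J), r x = x :=
    span_eqOn b J r LinearMap.id g3
  have rf : ∀ x, r (f x) = f (r x) := by intro x; simp [hr, hf]
  let q : F →ₗ[R] F := LinearMap.id - r
  have hq : ∀ x, q x = x - r x := fun x => rfl
  have qf : ∀ x, q (f x) = f (q x) := by intro x; rw [hq, hq, rf, map_sub]
  have q0 : ∀ x ∈ Submodule.span R (b '' J), q x = 0 := by
    intro x hx; rw [hq, rid x hx, sub_self]
  have qq : ∀ x, q (q x) = q x := by
    intro x; rw [hq x, map_sub, q0 _ (rJ x), sub_zero, hq]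
  let GK : Finset I → Submodule R F := fun K => (Submodule.span R (b '' (K : Set I))).map q
  have GKmono : Monotone GK := fun K K' hK =>
    Submodule.map_mono (Submodule.span_mono (Set.image_mono (by exact_mod_cast hK)))
  have qG : ∀ K, ∀ x ∈ GK K, q x = x := by
    rintro K _ ⟨y, -, rfl⟩; exact qq y
  have next : ∀ K : Finset I, ∃ (K' : Finset I) (τ : F →ₗ[R] F), K ⊆ K' ∧
      (∀ x, τ x ∈ GK K') ∧ (∀ x, f (τ x) ∈ GK K') ∧
      (∀ x ∈ GK K, f x = 0 → f (τ x) = x) ∧ (∀ x ∈ GK K, f x ∈ GK K') := by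
    intro K
    have hfg : (GK K).FG := (Submodule.fg_span (K.finite_toSet.image b)).map q
    obtain ⟨τ, L, hL, hτ, hτ'⟩ := H.fg hf (GK K) hfg
    have hfgτ : (L.map q).FG := hL.map q
    obtain ⟨K', hK'⟩ := fg_le_map b q
      (L.map q ⊔ ((L.map q).map f ⊔ (GK K).map f))
      (hfgτ.sup ((hfgτ.map f).sup (hfg.map f))) (by
        refine sup_le ?_ (sup_le ?_ ?_)
        · rintro _ ⟨x, -, rfl⟩; exact ⟨x, rfl⟩
        · rintro _ ⟨_, ⟨x, -, rfl⟩, rfl⟩; exact ⟨f x, qf _⟩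
        · rintro _ ⟨_, ⟨x, -, rfl⟩, rfl⟩; exact ⟨f x, qf _⟩)
    have hK'' : _ ≤ GK (K ∪ K') := hK'.trans (GKmono Finset.subset_union_right)
    refine ⟨K ∪ K', q ∘ₗ τ, Finset.subset_union_left, ?_, ?_, ?_, ?_⟩
    · exact fun x => hK'' (Submodule.mem_sup_left ⟨_, hτ x, rfl⟩)
    · exact fun x => hK'' (Submodule.mem_sup_right
        (Submodule.mem_sup_left ⟨_, ⟨_, hτ x, rfl⟩, rfl⟩))
    · intro x hx h0
      rw [LinearMap.comp_apply, ← qf, hτ' x hx h0, qG K x hx]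
    · exact fun x hx => hK'' (Submodule.mem_sup_right (Submodule.mem_sup_right ⟨x, hx, rfl⟩))
  choose Φ τ n1 n2 n3 n4 n5 using next
  obtain ⟨K, K0, Ks⟩ : ∃ K : ℕ → Finset I, K 0 = {i0} ∧ ∀ n, K (n + 1) = Φ (K n) :=
    ⟨fun n => Nat.rec {i0} (fun _ k => Φ k) n, rfl, fun n => rfl⟩
  have Kmono : Monotone K := monotone_nat_of_le_succ fun n => by rw [Ks]; exact n1 _
  obtain ⟨T, hT⟩ := telescope f hf (fun n => GK (K n)) (GKmono.comp Kmono) (fun n => τ (K n))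
    (fun n x => by rw [Ks]; exact n2 _ x) (fun n x => by rw [Ks]; exact n3 _ x)
    (fun n => n4 _) (fun n x => by rw [Ks]; exact n5 _ x)
  let J' : Set I := J ∪ ⋃ n : ℕ, ((K n : Finset I) : Set I)
  have JJ' : Submodule.span R (b '' J) ≤ Submodule.span R (b '' J') :=
    Submodule.span_mono (Set.image_mono Set.subset_union_left)
  have GJ' : ∀ n, ∀ x ∈ GK (K n), x ∈ Submodule.span R (b '' J') := by
    rintro n _ ⟨y, hy, rfl⟩
    rw [hq]
    refine sub_mem (Submodule.span_mono (Set.image_mono ?_) hy) (JJ' (rJ y))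
    exact Set.subset_union_of_subset_right (Set.subset_iUnion (fun n : ℕ => ((K n : Finset I) : Set I)) n) _
  have ex : ∀ j, ∃ n, j ∈ J' → q (b j) ∈ GK (K n) := by
    intro j
    by_cases hj : j ∈ J'
    · rcases hj with hj | hj
      · exact ⟨0, fun _ => by
          rw [q0 _ (Submodule.subset_span ⟨j, hj, rfl⟩)]; exact zero_mem _⟩
      · obtain ⟨n, hn⟩ := Set.mem_iUnion.1 hj
        exact ⟨n, fun _ => ⟨b j, Submodule.subset_span ⟨j, hn, rfl⟩, rfl⟩⟩
    · exact ⟨0, fun h => absurd h hj⟩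
  choose ν hν using ex
  let h' : F →ₗ[R] F := b.constr R fun j =>
    if j ∈ J' then h (r (b j)) + T (ν j + 3) (q (b j)) else 0
  have h'b : ∀ j ∈ J', h' (b j) = h (r (b j)) + T (ν j + 3) (q (b j)) := by
    intro j hj; simp only [h', Module.Basis.constr_basis, if_pos hj]
  have h'n : ∀ j, j ∉ J' → h' (b j) = 0 := by
    intro j hj; simp only [h', Module.Basis.constr_basis, if_neg hj]
  have ev : ∀ x ∈ Submodule.span R (b '' J'), ∃ N, ∀ m, N ≤ m →
      h' x = h (r x) + T m (q x) := by
    intro x hx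
    induction hx using Submodule.span_induction with
    | mem x hx =>
      obtain ⟨j, hj, rfl⟩ := hx
      refine ⟨ν j + 3, fun m hm => ?_⟩
      rw [h'b j hj, (hT (ν j) _ (hν j hj) m hm).1]
    | zero => exact ⟨0, fun m _ => by simp⟩
    | add x y _ _ ihx ihy =>
      obtain ⟨N, hN⟩ := ihx
      obtain ⟨N', hN'⟩ := ihy
      refine ⟨max N N', fun m hm => ?_⟩
      rw [map_add, hN m (by omega), hN' m (by omega)]
      simp only [map_add]; abel
    | smul c x _ ih =>
      obtain ⟨N, hN⟩ := ih
      refine ⟨N, fun m hm => ?_⟩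
      rw [map_smul, hN m hm]
      simp only [map_smul, smul_add]
  have fJ' : ∀ j ∈ J', f (b j) ∈ Submodule.span R (b '' J') := by
    intro j hj
    have : f (b j) = f (r (b j)) + f (q (b j)) := by rw [← map_add, hq]; congr 1; abel
    rw [this]
    refine add_mem (JJ' (fJ _ (rJ _))) (GJ' (ν j + 1) _ ?_)
    rw [Ks]; exact n5 _ _ (hν j hj)
  refine ⟨J', h', ⟨fJ', ?_, ?_, h'n⟩, Set.subset_union_left, ?_, ?_⟩
  · intro j hj
    simp only
    rw [h'b j hj]
    exact add_mem (JJ' (hJ _)) (GJ' _ _ (hT (ν j) _ (hν j hj) _ le_rfl).2.1)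
  · intro j hj
    simp only
    obtain ⟨N, hN⟩ := ev _ (fJ' j hj)
    obtain ⟨N', hN'⟩ := ev _ (Submodule.subset_span ⟨j, hj, rfl⟩)
    let m := max (max N N') (ν j + 3)
    rw [hN m (by omega), hN' m (by omega), rf, qf, map_add]
    have e1 := (hT (ν j) _ (hν j hj) m (by omega)).2.2
    have e2 : f (h (r (b j))) + h (f (r (b j))) = r (b j) := rid _ (rJ _)
    have e3 : b j = r (b j) + q (b j) := by rw [hq]; abel
    calc _ = (f (h (r (b j))) + h (f (r (b j)))) + (f (T m (q (b j))) + T m (f (q (b j)))) := by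
          abel
      _ = b j := by rw [e1, e2, ← e3]
  · exact Or.inr (Set.mem_iUnion.2 ⟨0, by simp [K0]⟩)
  · intro j hj
    have hj' : b j ∈ Submodule.span R (b '' J) := Submodule.subset_span ⟨j, hj, rfl⟩
    rw [h'b j (Or.inl hj), q0 _ hj', rid _ hj', map_zero, add_zero]

/-- A locally contractible differential on a free module is contractible. -/
theorem contr_of_locContr (b : Module.Basis I R F) (f : F →ₗ[R] F) (hf : ∀ x, f (f x) = 0)
    (H : LocContr f) : ∃ h : F →ₗ[R] F, ∀ x, f (h x) + h (f x) = x := by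
  classical
  let X := {p : Set I × (F →ₗ[R] F) // GoodPair b f p}
  let le : X → X → Prop := fun p p' => p.1.1 ⊆ p'.1.1 ∧ ∀ j ∈ p.1.1, p'.1.2 (b j) = p.1.2 (b j)
  have le_refl' : ∀ p, le p p := fun p => ⟨subset_rfl, fun _ _ => rfl⟩
  obtain ⟨⟨⟨J, h⟩, hg⟩, hmax⟩ := exists_maximal_of_chains_bounded (r := le) (by
    intro c hc
    let J : Set I := ⋃ p ∈ c, p.1.1
    have hJ : ∀ p ∈ c, p.1.1 ⊆ J := fun p hp => Set.subset_biUnion_of_mem (u := fun p : X => p.1.1) hp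
    have ex : ∀ j, ∃ v : F, (j ∈ J → ∃ p ∈ c, j ∈ p.1.1 ∧ v = p.1.2 (b j)) ∧ (j ∉ J → v = 0) := by
      intro j
      by_cases hj : j ∈ J
      · obtain ⟨p, hp, hjp⟩ := Set.mem_iUnion₂.1 hj
        exact ⟨p.1.2 (b j), fun _ => ⟨p, hp, hjp, rfl⟩, fun h => absurd hj h⟩
      · exact ⟨0, fun h => absurd h hj, fun _ => rfl⟩
    choose v hv hv0 using ex
    let h : F →ₗ[R] F := b.constr R v
    have hb : ∀ j, h (b j) = v j := fun j => by simp [h]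
    have key : ∀ p ∈ c, ∀ j ∈ p.1.1, h (b j) = p.1.2 (b j) := by
      intro p hp j hj
      obtain ⟨p', hp', hj', e⟩ := hv j (hJ p hp hj)
      rw [hb, e]
      by_cases hpp : p = p'
      · rw [hpp]
      · rcases hc hp hp' hpp with h1 | h1
        · exact h1.2 j hj
        · exact (h1.2 j hj').symm
    have key' : ∀ p ∈ c, ∀ x ∈ Submodule.span R (b '' p.1.1), h x = p.1.2 x :=
      fun p hp => span_eqOn b _ _ _ (key p hp)
    refine ⟨⟨(J, h), ?_, ?_, ?_, ?_⟩, fun p hp => ⟨hJ p hp, key p hp⟩⟩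
    · intro j hj
      obtain ⟨p, hp, hjp⟩ := Set.mem_iUnion₂.1 hj
      exact Submodule.span_mono (Set.image_mono (hJ p hp)) (p.2.1 j hjp)
    · intro j hj
      obtain ⟨p, hp, hjp⟩ := Set.mem_iUnion₂.1 hj
      simp only
      rw [key p hp j hjp]
      exact Submodule.span_mono (Set.image_mono (hJ p hp)) (p.2.2.1 j hjp)
    · intro j hj
      obtain ⟨p, hp, hjp⟩ := Set.mem_iUnion₂.1 hj
      simp only
      rw [key p hp j hjp, key' p hp _ (p.2.1 j hjp)]
      exact p.2.2.2.1 j hjp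
    · intro j hj
      simp only
      rw [hb, hv0 j hj])
    (by
      rintro p p' p'' ⟨h1, h2⟩ ⟨h3, h4⟩
      exact ⟨h1.trans h3, fun j hj => (h4 j (h1 hj)).trans (h2 j hj)⟩)
  have hall : ∀ i, i ∈ J := by
    intro i
    obtain ⟨J', h', hg', hJJ, hi, hh⟩ := good_step b f hf H J h hg i
    exact (hmax ⟨(J', h'), hg'⟩ ⟨hJJ, hh⟩).1 hi
  refine ⟨h, fun x => ?_⟩
  have : f ∘ₗ h + h ∘ₗ f = LinearMap.id := b.ext fun j => hg.2.2.1 j (hall j)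
  exact LinearMap.congr_fun this x

end Core

section Split

variable {R : Type*} [CommRing R]

theorem locContr_of_basis {F I : Type*} [AddCommGroup F] [Module R F] (b : Module.Basis I R F)
    (f : F →ₗ[R] F) (H : ∀ S : Finset F, (∀ x ∈ S, f x = 0) →
      ∃ σ : F →ₗ[R] F, ∀ x ∈ S, f (σ x) = x) : LocContr f := by
  classical
  intro S hS
  obtain ⟨σ, hσ⟩ := H S hS
  let K : Finset I := S.biUnion fun x => (b.repr x).support
  let π : F →ₗ[R] F := b.constr R fun i => if i ∈ K then b i else 0
  have hπ : ∀ i, π (b i) = if i ∈ K then b i else 0 := fun i => by simp [π]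
  refine ⟨σ ∘ₗ π, (Submodule.span R (b '' (K : Set I))).map σ,
    (Submodule.fg_span (K.finite_toSet.image b)).map σ, ?_, ?_⟩
  · apply all_maps b
    intro j
    rw [LinearMap.comp_apply, hπ]
    refine ⟨_, ?_, rfl⟩
    split_ifs with h
    · exact Submodule.subset_span ⟨j, h, rfl⟩
    · exact zero_mem _
  · intro x hx
    have : π x = LinearMap.id (R := R) x := by
      refine span_eqOn b (K : Set I) π LinearMap.id ?_ x ?_
      · intro j hj
        rw [hπ, if_pos (by exact_mod_cast hj)]; rfl
      · rw [b.mem_span_image]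
        exact_mod_cast Finset.subset_biUnion_of_mem (fun x => (b.repr x).support) hx
    rw [LinearMap.comp_apply, this, LinearMap.id_apply, hσ x hx]

theorem finite_part {P : Type*} [AddCommGroup P] [Module R P] [Module.Projective R P]
    (S : Finset P) : ∃ (K : Finset P) (inc : (K →₀ R) →ₗ[R] P) (res : P →ₗ[R] (K →₀ R)),
      ∀ x ∈ S, inc (res x) = x := by
  classical
  obtain ⟨ι, hι⟩ := Module.projective_def'.1 (inferInstance : Module.Projective R P)
  refine ⟨S.biUnion fun x => (ι x).support,
    Finsupp.linearCombination R _root_.id ∘ₗ Finsupp.lmapDomain R R Subtype.val,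
    Finsupp.lcomapDomain Subtype.val Subtype.val_injective ∘ₗ ι, fun x hx => ?_⟩
  have h1 : Finsupp.mapDomain Subtype.val (Finsupp.comapDomain Subtype.val (ι x)
      (Subtype.val_injective (p := fun i => i ∈ S.biUnion fun x => (ι x).support)).injOn)
        = ι x := by
    refine Finsupp.mapDomain_comapDomain _ Subtype.val_injective _ ?_
    intro i hi
    exact ⟨⟨i, Finset.mem_biUnion.2 ⟨x, hx, hi⟩⟩, rfl⟩
  have h2 := LinearMap.congr_fun hι x
  rw [LinearMap.comp_apply, ← h1] at h2
  exact h2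

theorem loc_of_flat {P : Type*} [AddCommGroup P] [Module R P] [Module.Projective R P]
    (f : P →ₗ[R] P) (hex : ∀ x, f x = 0 → x ∈ LinearMap.range f)
    {C : Type*} [AddCommGroup C] [Module R C] [Module.Flat R C] (p : P →ₗ[R] C)
    (hps : Function.Surjective p) (hp : ∀ x, p x = 0 ↔ f x = 0)
    (S : Finset P) (hS : ∀ x ∈ S, f x = 0) :
    ∃ σ : P →ₗ[R] P, ∀ x ∈ S, f (σ x) = x := by
  classical
  obtain ⟨K, inc, res, hir⟩ := finite_part (R := R) S
  have hfg : (Submodule.span R (res '' (S : Set P))).FG :=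
    Submodule.fg_span (S.finite_toSet.image res)
  have hfin : Module.Finite R (Submodule.span R (res '' (S : Set P))) := Module.Finite.of_fg hfg
  have hW : Submodule.span R (res '' (S : Set P)) ≤ LinearMap.ker (p ∘ₗ inc) := by
    refine Submodule.span_le.2 ?_
    rintro _ ⟨s, hs, rfl⟩
    rw [SetLike.mem_coe, LinearMap.mem_ker, LinearMap.comp_apply, hir s hs, hp]
    exact hS s hs
  obtain ⟨k, a, y, hya, haW⟩ := Module.Flat.exists_factorization_of_comp_eq_zero_of_free
    (K := (Submodule.span R (res '' (S : Set P)) : Submodule R (K →₀ R)))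
    (f := (Submodule.span R (res '' (S : Set P))).subtype) (x := p ∘ₗ inc)
    (LinearMap.ext fun w => hW w.2)
  obtain ⟨z, hz⟩ := Module.projective_lifting_property p y hps
  have hθ : ∀ x, ((inc - z ∘ₗ a) ∘ₗ res) x ∈ LinearMap.range f := by
    intro x
    apply hex
    rw [← hp]
    have h1 := LinearMap.congr_fun hya (res x)
    have h2 := LinearMap.congr_fun hz (a (res x))
    simp only [LinearMap.comp_apply] at h1 h2
    simp only [LinearMap.comp_apply, LinearMap.sub_apply, map_sub]
    rw [h1, h2, sub_self]
  obtain ⟨σ, hσ⟩ := Module.projective_lifting_property f.rangeRestrict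
    (LinearMap.codRestrict _ _ hθ) f.surjective_rangeRestrict
  refine ⟨σ, fun x hx => ?_⟩
  have h1 := congrArg Subtype.val (LinearMap.congr_fun hσ x)
  have h2 : a (res x) = 0 := LinearMap.congr_fun haW ⟨res x, Submodule.subset_span ⟨x, hx, rfl⟩⟩
  change f (σ x) = inc (res x) - z (a (res x)) at h1
  rw [h1, h2, hir x hx, map_zero, sub_zero]

/-- Benson–Goodearl: a periodic flat module is projective. -/
theorem split_of_flat {P : Type*} [AddCommGroup P] [Module R P] [Module.Projective R P]
    (f : P →ₗ[R] P) (hf : ∀ x, f (f x) = 0) (hex : ∀ x, f x = 0 → x ∈ LinearMap.range f)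
    {C : Type*} [AddCommGroup C] [Module R C] [Module.Flat R C] (p : P →ₗ[R] C)
    (hps : Function.Surjective p) (hp : ∀ x, p x = 0 ↔ f x = 0) :
    ∃ s : P →ₗ[R] P, ∀ x, f x = 0 → f (s x) = x := by
  classical
  obtain ⟨ι, hι⟩ := Module.projective_def'.1 (inferInstance : Module.Projective R P)
  let L := P →₀ R
  let ρ : L →ₗ[R] P := Finsupp.linearCombination R _root_.id
  have hρ : ∀ x, ρ (ι x) = x := fun x => LinearMap.congr_fun hι x
  let A := LinearMap.fst R L L
  let B := LinearMap.snd R L L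
  let d : L × L →ₗ[R] L × L :=
    LinearMap.prod (ι ∘ₗ f ∘ₗ ρ ∘ₗ A + (B - ι ∘ₗ ρ ∘ₗ B)) (ι ∘ₗ f ∘ₗ ρ ∘ₗ B)
  have hd : ∀ x y, d (x, y) = (ι (f (ρ x)) + (y - ι (ρ y)), ι (f (ρ y))) := fun x y => rfl
  have hdd : ∀ x, d (d x) = 0 := by
    rintro ⟨x, y⟩
    simp [hd, hρ, hf]
  let b : Module.Basis (P ⊕ P) R (L × L) :=
    (Finsupp.basisSingleOne (R := R) (ι := P)).prod (Finsupp.basisSingleOne (R := R) (ι := P))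
  have hloc : LocContr d := by
    apply locContr_of_basis b
    intro S hS
    have hk : ∀ p ∈ S, f (ρ p.1) = 0 ∧ f (ρ p.2) = 0 ∧ ι (ρ p.2) = p.2 := by
      rintro ⟨x, y⟩ hp
      have h0 := hS _ hp
      rw [hd, Prod.mk_eq_zero] at h0
      have h1 := congrArg ρ h0.1
      have h2 := congrArg ρ h0.2
      simp only [map_add, map_sub, hρ, sub_self, add_zero, map_zero] at h1 h2
      refine ⟨h1, h2, ?_⟩
      have h3 := h0.1
      rw [h1, map_zero, zero_add, sub_eq_zero] at h3
      exact h3.symm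
    obtain ⟨σ, hσ⟩ := loc_of_flat f hex p hps hp (S.image (fun p => ρ p.1) ∪ S.image (fun p => ρ p.2)) (by
      intro x hx
      rcases Finset.mem_union.1 hx with hx | hx
      · obtain ⟨p, hp, rfl⟩ := Finset.mem_image.1 hx
        exact (hk p hp).1
      · obtain ⟨p, hp, rfl⟩ := Finset.mem_image.1 hx
        exact (hk p hp).2.1)
    refine ⟨LinearMap.prod (ι ∘ₗ σ ∘ₗ ρ ∘ₗ A)
      (ι ∘ₗ σ ∘ₗ ρ ∘ₗ B + (A - ι ∘ₗ ρ ∘ₗ A)), ?_⟩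
    rintro ⟨x, y⟩ hp
    have h1 := hσ (ρ x) (Finset.mem_union_left _ (Finset.mem_image_of_mem (fun p : L × L => ρ p.1) hp))
    have h2 := hσ (ρ y) (Finset.mem_union_right _ (Finset.mem_image_of_mem (fun p : L × L => ρ p.2) hp))
    have h3 := (hk _ hp).2.2
    change d (ι (σ (ρ x)), ι (σ (ρ y)) + (x - ι (ρ x))) = _
    simp only at h3
    simp [hd, hρ, h1, h2, h3]
  obtain ⟨h, hh⟩ := contr_of_locContr b d hdd hloc
  refine ⟨ρ ∘ₗ A ∘ₗ h ∘ₗ LinearMap.inl R L L ∘ₗ ι, fun x hx => ?_⟩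
  have h1 := hh (ι x, 0)
  have h2 : d (ι x, 0) = 0 := by simp [hd, hρ, hx]
  rw [h2, map_zero, add_zero] at h1
  have h3 := congrArg (fun p : L × L => ρ p.1) h1
  have h4 : d (h (ι x, 0)) = d ((h (ι x, 0)).1, (h (ι x, 0)).2) := rfl
  rw [h4, hd] at h3
  simpa [A, hρ] using h3

end Split

section Complex
variable {R : Type u} [CommRing R]

theorem comapDomain_surj (P : ℤ → ModuleCat.{u} R) :
    Function.Surjective (DFinsupp.comapDomain (β := fun i => P i) (fun i : ℤ => i + 1)
      (add_left_injective 1)) := by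
  intro x
  induction x using DFinsupp.induction with
  | h0 => exact ⟨0, by simp⟩
  | ha i b x _ _ ih =>
    obtain ⟨y, rfl⟩ := ih
    exact ⟨DFinsupp.single (i + 1) b + y, by
      rw [DFinsupp.comapDomain_add,
        DFinsupp.comapDomain_single (β := fun i => P i) (fun i : ℤ => i + 1)]⟩

theorem proj_of_flat_cycles (P : ℤ → ModuleCat.{u} R) (d : ∀ i : ℤ, P (i + 1) →ₗ[R] P i)
    (hP : ∀ i, Module.Projective R (P i)) (hdd : ∀ i, d i ∘ₗ d (i + 1) = 0)
    (hex : ∀ i, LinearMap.ker (d i) = LinearMap.range (d (i + 1)))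
    (hfl : ∀ i, Module.Flat R (LinearMap.range (d i))) :
    Module.Projective R (LinearMap.range (d 0)) := by
  classical
  let sh : (Π₀ i, P i) →ₗ[R] (Π₀ i : ℤ, P (i + 1)) :=
    { toFun := DFinsupp.comapDomain (β := fun i => P i) (fun i : ℤ => i + 1) (add_left_injective 1)
      map_add' := fun x y => DFinsupp.comapDomain_add _ _ _ _
      map_smul' := fun c x => DFinsupp.comapDomain_smul _ _ _ _ }
  have hsh : ∀ x i, sh x i = x (i + 1) := fun x i => rfl
  have shs : Function.Surjective sh := comapDomain_surj P
  let g : (Π₀ i, P i) →ₗ[R] (Π₀ i : ℤ, LinearMap.range (d i)) :=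
    DFinsupp.mapRange.linearMap (fun i => (d i).rangeRestrict) ∘ₗ sh
  let f : (Π₀ i, P i) →ₗ[R] (Π₀ i, P i) := DFinsupp.mapRange.linearMap d ∘ₗ sh
  have hfa : ∀ x i, f x i = d i (x (i + 1)) := fun x i => rfl
  have hga : ∀ x i, ((g x i : LinearMap.range (d i)) : P i) = d i (x (i + 1)) := fun x i => rfl
  have hgs : Function.Surjective g := by
    rw [LinearMap.coe_comp]
    refine Function.Surjective.comp ?_ shs
    exact (DFinsupp.mapRange_surjective (fun i => (d i).rangeRestrict) (fun i => map_zero _)).2 fun i => (d i).surjective_rangeRestrict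
  have hker : LinearMap.ker g = LinearMap.ker f := by
    ext x
    rw [LinearMap.mem_ker, LinearMap.mem_ker, DFinsupp.ext_iff, DFinsupp.ext_iff]
    refine forall_congr' fun i => ?_
    rw [← Subtype.coe_inj, hga, hfa]; rfl
  have : Module.Projective R (Π₀ i, P i) :=
    (inferInstance : Module.Projective R (DirectSum ℤ fun i => P i))
  have hff : ∀ x, f (f x) = 0 := by
    intro x
    ext i
    rw [hfa, hfa]
    exact LinearMap.congr_fun (hdd i) _
  have hfex : ∀ x, f x = 0 → x ∈ LinearMap.range f := by
    intro x hx
    have h1 : ∀ j, x j ∈ LinearMap.range (d j) := by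
      intro j
      obtain ⟨i, rfl⟩ : ∃ i, j = i + 1 := ⟨j - 1, by ring⟩
      rw [← hex, LinearMap.mem_ker, ← hfa, hx]; rfl
    have ex : ∀ j (v : P j), ∃ w : P (j + 1), (v ∈ LinearMap.range (d j) → d j w = v) ∧
        (v = 0 → w = 0) := by
      intro j v
      by_cases hv : v = 0
      · exact ⟨0, fun _ => by simp [hv], fun _ => rfl⟩
      · by_cases hv' : v ∈ LinearMap.range (d j)
        · obtain ⟨w, hw⟩ := hv'
          exact ⟨w, fun _ => hw, fun h => absurd h hv⟩
        · exact ⟨0, fun h => absurd h hv', fun _ => rfl⟩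
    choose u hu hu0 using ex
    obtain ⟨y, hy⟩ := shs (DFinsupp.mapRange u (fun j => hu0 j 0 rfl) x)
    refine ⟨y, DFinsupp.ext fun j => ?_⟩
    rw [hfa, ← hsh, hy, DFinsupp.mapRange_apply, hu j _ (h1 j)]
  obtain ⟨s, hs⟩ := split_of_flat f hff hfex g hgs (fun x => by
    rw [← LinearMap.mem_ker, hker, LinearMap.mem_ker])
  let sg : LinearMap.range (d 0) →ₗ[R] (Π₀ i, P i) :=
    DFinsupp.lsingle (M := fun i => P i) 0 ∘ₗ (LinearMap.range (d 0)).subtype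
  have hsg : ∀ z, f (sg z) = 0 := by
    rintro ⟨_, w, rfl⟩
    have : sg ⟨d 0 w, w, rfl⟩ = f (DFinsupp.single (0 + 1) w) := by
      change DFinsupp.single 0 (d 0 w) = DFinsupp.mapRange.linearMap d
        (DFinsupp.comapDomain (β := fun i => P i) (fun i : ℤ => i + 1) (add_left_injective 1)
          (DFinsupp.single (0 + 1) w))
      rw [DFinsupp.comapDomain_single (β := fun i => P i) (fun i : ℤ => i + 1)]
      exact (DFinsupp.mapRange_single (f := fun i => d i) (hf := fun i => map_zero _)).symm
    rw [this, hff]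
  refine Module.Projective.of_split (M := P (0 + 1))
    (DFinsupp.lapply (M := fun i => P i) (0 + 1) ∘ₗ s ∘ₗ sg) (d 0).rangeRestrict ?_
  refine LinearMap.ext fun z => Subtype.ext ?_
  change d 0 ((s (sg z)) (0 + 1)) = z.1
  rw [← hfa, hs _ (hsg z)]
  exact DFinsupp.single_eq_same

end Complex

section Final
variable {R : Type u} [CommRing R]

theorem FlatDimLE.of_equiv (n : ℕ) {M N : ModuleCat.{u} R} (h : FlatDimLE R n M)
    (e : M ≃ₗ[R] N) : FlatDimLE R n N := by
  cases n with
  | zero =>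
    have : Module.Flat R M := h
    exact Module.Flat.of_linearEquiv e.symm
  | succ n =>
    obtain ⟨G, p, hG, hp, hk⟩ := h
    refine ⟨G, e.toLinearMap ∘ₗ p, hG, e.surjective.comp hp, ?_⟩
    rwa [LinearEquiv.ker_comp]

theorem FlatDimLE.syzygy (n : ℕ) (M P : ModuleCat.{u} R) (hP : Module.Projective R P)
    (π : P →ₗ[R] M) (hπ : Function.Surjective π) (h : FlatDimLE R (n + 1) M) :
    FlatDimLE R n (ModuleCat.of R (LinearMap.ker π)) := by
  obtain ⟨G, p, hG, hp, hk⟩ := h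
  obtain ⟨lam, hlam'⟩ := Module.projective_lifting_property p π hp
  have hlam : ∀ x, p (lam x) = π x := fun x => LinearMap.congr_fun hlam' x
  have main : ∀ (G1 : ModuleCat.{u} R) (p1 : G1 →ₗ[R] LinearMap.ker p), Module.Flat R G1 →
      Function.Surjective p1 → ∃ (K : ModuleCat.{u} R) (t : K →ₗ[R] LinearMap.ker π),
        Module.Flat R K ∧ Function.Surjective t ∧
          Nonempty (LinearMap.ker p1 ≃ₗ[R] LinearMap.ker t) := by
    intro G1 p1 hG1 hp1
    let w : (G1 × P) →ₗ[R] G := LinearMap.coprod ((LinearMap.ker p).subtype ∘ₗ p1) lam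
    have hwa : ∀ a b, w (a, b) = (p1 a : G) + lam b := fun a b => by simp [w]
    have hw : Function.Surjective w := by
      intro g
      obtain ⟨x, hx⟩ := hπ (p g)
      have hm : g - lam x ∈ LinearMap.ker p := by
        rw [LinearMap.mem_ker, map_sub, hlam, hx, sub_self]
      obtain ⟨a, ha⟩ := hp1 ⟨_, hm⟩
      exact ⟨(a, x), by rw [hwa, ha]; simp⟩
    have f1 : Module.Flat R (G1 × P) := flat_prod
    have f2 : Module.Flat R (LinearMap.ker w) := flat_ker w hw
    have ht : ∀ z : LinearMap.ker w, z.1.2 ∈ LinearMap.ker π := by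
      rintro ⟨⟨a, b⟩, hz⟩
      rw [LinearMap.mem_ker, hwa] at hz
      have := congrArg p hz
      rw [map_add, hlam, map_zero, (p1 a).2, zero_add] at this
      exact this
    let t : LinearMap.ker w →ₗ[R] LinearMap.ker π :=
      LinearMap.codRestrict _ (LinearMap.snd R G1 P ∘ₗ (LinearMap.ker w).subtype) ht
    have hta : ∀ z, (t z : P) = z.1.2 := fun z => rfl
    refine ⟨ModuleCat.of R (LinearMap.ker w), t, f2, ?_, ?_⟩
    · rintro ⟨x, hx⟩
      have hm : - lam x ∈ LinearMap.ker p := by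
        rw [LinearMap.mem_ker, map_neg, hlam, hx, neg_zero]
      obtain ⟨a, ha⟩ := hp1 ⟨_, hm⟩
      exact ⟨⟨(a, x), by rw [LinearMap.mem_ker, hwa, ha]; simp⟩, rfl⟩
    · have hi1 : ∀ a : LinearMap.ker p1, ((a : G1), (0 : P)) ∈ LinearMap.ker w := by
        intro a
        rw [LinearMap.mem_ker, hwa, LinearMap.mem_ker.1 a.2]; simp
      let i1 : LinearMap.ker p1 →ₗ[R] LinearMap.ker w :=
        LinearMap.codRestrict _ (LinearMap.inl R G1 P ∘ₗ (LinearMap.ker p1).subtype) hi1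
      have hi2 : ∀ a, i1 a ∈ LinearMap.ker t := fun a => by
        rw [LinearMap.mem_ker]; exact Subtype.ext rfl
      refine ⟨LinearEquiv.ofBijective (LinearMap.codRestrict _ i1 hi2) ⟨?_, ?_⟩⟩
      · intro a a' haa
        have := congrArg (fun z : LinearMap.ker t => z.1.1.1) haa
        exact Subtype.ext this
      · rintro ⟨⟨⟨a, b⟩, hz⟩, hz'⟩
        have hb : b = 0 := congrArg Subtype.val (LinearMap.mem_ker.1 hz')
        subst hb
        have ha : p1 a = 0 := by
          rw [LinearMap.mem_ker, hwa, map_zero, add_zero] at hz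
          exact Subtype.ext hz
        exact ⟨⟨a, ha⟩, rfl⟩
  cases n with
  | zero =>
    obtain ⟨K, t, hK, ht, ⟨e⟩⟩ := main (ModuleCat.of R (LinearMap.ker p)) LinearMap.id hk
      Function.surjective_id
    have hinj : Function.Injective t := by
      rw [← LinearMap.ker_eq_bot, Submodule.eq_bot_iff]
      intro x hx
      obtain ⟨y, hy⟩ := e.surjective ⟨x, hx⟩
      have hy0 : y = 0 := Subtype.ext y.2
      rw [hy0, map_zero] at hy
      exact (congrArg Subtype.val hy).symm
    exact Module.Flat.of_linearEquiv (LinearEquiv.ofBijective t ⟨hinj, ht⟩).symm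
  | succ n =>
    obtain ⟨G1, p1, hG1, hp1, hk1⟩ := hk
    obtain ⟨K, t, hK, ht, ⟨e⟩⟩ := main G1 p1 hG1 hp1
    exact ⟨K, t, hK, ht, FlatDimLE.of_equiv n hk1 e⟩

theorem gproj_proj (hwd : ∃ n : ℕ, ∀ M : ModuleCat.{u} R, FlatDimLE R n M)
    (M : ModuleCat.{u} R) (hM : IsGProjective R M) : Module.Projective R M := by
  obtain ⟨P, d, hP, hdd, hex, ⟨e⟩, -⟩ := hM
  obtain ⟨n, hn⟩ := hwd
  have step : ∀ n : ℕ, ∀ i, FlatDimLE R n (ModuleCat.of R (LinearMap.range (d i))) →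
      Module.Flat R (LinearMap.range (d (i + n))) := by
    intro n
    induction n with
    | zero =>
      intro i hi
      have : i + ((0 : ℕ) : ℤ) = i := by simp
      rw [this]; exact hi
    | succ n ih =>
      intro i hi
      have h1 := FlatDimLE.syzygy n (ModuleCat.of R (LinearMap.range (d i))) (P (i + 1)) (hP _)
        (d i).rangeRestrict (d i).surjective_rangeRestrict hi
      rw [LinearMap.ker_rangeRestrict, hex] at h1
      have h2 := ih (i + 1) h1
      have : i + ((n + 1 : ℕ) : ℤ) = i + 1 + n := by push_cast; ring
      rw [this]; exact h2
  have hfl : ∀ i, Module.Flat R (LinearMap.range (d i)) := by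
    intro j
    obtain ⟨i, rfl⟩ : ∃ i : ℤ, j = i + n := ⟨j - n, by ring⟩
    exact step n i (hn _)
  have := proj_of_flat_cycles P d hP hdd hex hfl
  exact Module.Projective.of_equiv e.symm

theorem sgproj_gproj (M : ModuleCat.{u} R) (hM : IsSGProjective R M) : IsGProjective R M := by
  obtain ⟨P, hP, f, hff, hex, he, hQ⟩ := hM
  exact ⟨fun _ => P, fun _ => f, fun _ => hP, fun _ => hff, fun _ => hex, he,
    fun Q hq _ g hg => hQ Q hq g hg⟩

theorem proj_sgproj (M : ModuleCat.{u} R) (hM : Module.Projective R M) : IsSGProjective R M := by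
  let f : (M × M) →ₗ[R] (M × M) := LinearMap.inl R M M ∘ₗ LinearMap.snd R M M
  have hfa : ∀ x y, f (x, y) = (y, 0) := fun x y => rfl
  have hr : ∀ z : M × M, z ∈ LinearMap.range f ↔ z.2 = 0 := by
    rintro ⟨x, y⟩
    constructor
    · rintro ⟨⟨a, b⟩, h⟩
      rw [hfa] at h
      exact (congrArg Prod.snd h).symm
    · rintro rfl
      exact ⟨(0, x), rfl⟩
  refine ⟨ModuleCat.of R (M × M), (inferInstance : Module.Projective R (M × M)), f, ?_, ?_, ?_, ?_⟩
  · exact LinearMap.ext fun z => rfl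
  · refine Submodule.ext fun z => ?_
    rw [hr, LinearMap.mem_ker]
    obtain ⟨x, y⟩ := z
    rw [hfa]
    simp
  · have hm : ∀ x : M, LinearMap.inl R M M x ∈ LinearMap.range f := fun x => (hr _).2 rfl
    refine ⟨LinearEquiv.ofBijective (LinearMap.codRestrict _ (LinearMap.inl R M M) hm) ⟨?_, ?_⟩⟩
    · intro x y h
      exact congrArg (fun z : LinearMap.range f => z.1.1) h
    · rintro ⟨⟨x, y⟩, hz⟩
      have : y = 0 := (hr _).1 hz
      subst this
      exact ⟨x, rfl⟩
  · intro Q _ g hg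
    let g' : (M × M) →ₗ[R] Q := g
    refine ⟨(g' ∘ₗ LinearMap.inr R M M ∘ₗ LinearMap.fst R M M : (M × M) →ₗ[R] Q), ?_⟩
    refine LinearMap.ext fun z => ?_
    obtain ⟨x, y⟩ := z
    have h0 : g' (x, 0) = 0 := LinearMap.congr_fun hg ((0, x) : M × M)
    change g' (x, y) = g' (0, y)
    have : ((x, y) : M × M) = (x, 0) + (0, y) := by simp
    rw [this, map_add, h0, zero_add]

theorem proj_resolving (A B C : ModuleCat.{u} R) (i : A →ₗ[R] B) (p : B →ₗ[R] C)
    (hi : Function.Injective i) (hp : Function.Surjective p)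
    (hex : LinearMap.range i = LinearMap.ker p) (hC : Module.Projective R C) :
    Module.Projective R A ↔ Module.Projective R B := by
  obtain ⟨s, hs'⟩ := Module.projective_lifting_property p LinearMap.id hp
  have hs : ∀ x, p (s x) = x := fun x => LinearMap.congr_fun hs' x
  have hpi : ∀ a, p (i a) = 0 := fun a => by
    rw [← LinearMap.mem_ker, ← hex]; exact ⟨a, rfl⟩
  have e : (A × C) ≃ₗ[R] B := by
    refine LinearEquiv.ofBijective (LinearMap.coprod i s) ⟨?_, ?_⟩
    · rw [← LinearMap.ker_eq_bot, Submodule.eq_bot_iff]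
      rintro ⟨a, c⟩ h
      rw [LinearMap.mem_ker, LinearMap.coprod_apply] at h
      simp only at h
      have h1 := congrArg p h
      rw [map_add, hpi, hs, zero_add, map_zero] at h1
      subst h1
      rw [map_zero, add_zero] at h
      rw [hi (h.trans (map_zero i).symm)]; rfl
    · intro b
      have : b - s (p b) ∈ LinearMap.range i := by
        rw [hex, LinearMap.mem_ker, map_sub, hs, sub_self]
      obtain ⟨a, ha⟩ := this
      exact ⟨(a, p b), by rw [LinearMap.coprod_apply]; simp [ha]⟩
  constructor
  · intro hA
    exact Module.Projective.of_equiv e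
  · intro hB
    have : Module.Projective R (A × C) := Module.Projective.of_equiv e.symm
    exact Module.Projective.of_split (LinearMap.inl R A C) (LinearMap.fst R A C)
      (LinearMap.ext fun _ => rfl)

end Final

/-- Over a commutative ring of finite weak global dimension, every Gorenstein
projective module is projective; hence the class of strongly Gorenstein projective modules
equals the class of projective modules and is projectively resolving. -/
theorem stmt17 (R : Type u) [CommRing R]
    (hwd : ∃ n : ℕ, ∀ M : ModuleCat.{u} R, FlatDimLE R n M) :
    (∀ M : ModuleCat.{u} R, IsGProjective R M → Module.Projective R M) ∧
    (∀ M : ModuleCat.{u} R, IsSGProjective R M ↔ Module.Projective R M) ∧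
    ProjResolving R (fun N : ModuleCat.{u} R => IsSGProjective R N) := by
  have h1 := gproj_proj hwd
  have h2 : ∀ M : ModuleCat.{u} R, IsSGProjective R M ↔ Module.Projective R M :=
    fun M => ⟨fun h => h1 M (sgproj_gproj M h), proj_sgproj M⟩
  refine ⟨h1, h2, proj_sgproj, ?_⟩
  intro A B C i p hi hp hex hC
  simp only [h2] at hC ⊢
  exact proj_resolving A B C i p hi hp hex hC
end

section
/- Let R₁, R₂ be rings each of finite Gorenstein global dimension, and suppose every Gorenstein projective Rᵢ-module is strongly Gorenstein projective for i = 1, 2. Then every Gorenstein projective (R₁×R₂)-module is strongly Gorenstein projective. -/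
universe u

open LinearMap DirectSum

theorem aux_trans (S A Q : Type u) [CommRing S] [CommRing A] [Algebra S A]
    [hA : Module.Projective S A] [AddCommGroup Q] [Module S Q] [Module A Q] [IsScalarTower S A Q]
    [hQ : Module.Projective A Q] : Module.Projective S Q := by
  classical
  obtain ⟨s, hs⟩ := Module.projective_def'.mp hQ
  have : Module.Projective S (Q →₀ A) :=
    Module.Projective.of_equiv' (finsuppLequivDFinsupp (ι := Q) (M := A) S).symm
  refine Module.Projective.of_split (M := Q →₀ A) (s.restrictScalars S)
    ((Finsupp.linearCombination A (id : Q → Q)).restrictScalars S) ?_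
  ext x
  exact LinearMap.congr_fun hs x

open scoped TensorProduct in
theorem aux_baseChange (S A : Type u) [CommRing S] [CommRing A] [Algebra S A]
    [Module.Projective S A] (M : Type u) [AddCommGroup M] [Module S M]
    (hM : IsGProjective S M) : IsGProjective A (A ⊗[S] M) := by
  obtain ⟨P, d, hP, hdd, hex, ⟨e⟩, hQ⟩ := hM
  have hexact : ∀ {X Y Z : Type u} [AddCommGroup X] [AddCommGroup Y] [AddCommGroup Z]
      [Module S X] [Module S Y] [Module S Z] (f : X →ₗ[S] Y) (g : Y →ₗ[S] Z),
      Function.Exact f g → Function.Exact (f.baseChange A) (g.baseChange A) := by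
    intro X Y Z _ _ _ _ _ _ f g h
    exact Module.Flat.lTensor_exact A h
  refine ⟨fun i => ModuleCat.of A (A ⊗[S] P i), fun i => (d i).baseChange A, ?_, ?_, ?_, ?_, ?_⟩
  · intro i
    have := hP i
    exact (inferInstance : Module.Projective A (A ⊗[S] P i))
  · intro i
    have := congrArg (LinearMap.baseChange A) (hdd i)
    rw [LinearMap.baseChange_comp, LinearMap.baseChange_zero] at this
    exact this
  · intro i
    exact (LinearMap.exact_iff.mp (hexact (d (i+1)) (d i) (LinearMap.exact_iff.mpr (hex i))))
  · let j : M →ₗ[S] P 0 := (LinearMap.range (d 0)).subtype ∘ₗ e.toLinearMap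
    have hj : Function.Injective j := Subtype.val_injective.comp e.injective
    let q : P (0+1) →ₗ[S] M := e.symm.toLinearMap ∘ₗ (d 0).rangeRestrict
    have hq : Function.Surjective q := e.symm.surjective.comp (d 0).surjective_rangeRestrict
    have hjq : j ∘ₗ q = d 0 := by ext x; simp [j, q]
    have hJ : Function.Injective (j.baseChange A) :=
      Module.Flat.lTensor_preserves_injective_linearMap (M := A) j hj
    have hQ' : Function.Surjective (q.baseChange A) := LinearMap.lTensor_surjective A hq
    have hr : LinearMap.range (j.baseChange A) = LinearMap.range ((d 0).baseChange A) := by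
      have h0 : (d 0).baseChange A = j.baseChange A ∘ₗ q.baseChange A := by
        rw [← LinearMap.baseChange_comp, hjq]
      rw [h0]
      exact (LinearMap.range_comp_of_range_eq_top _ (LinearMap.range_eq_top.mpr hQ')).symm
    exact ⟨(LinearEquiv.ofInjective _ hJ).trans (LinearEquiv.ofEq _ _ hr)⟩
  · intro Q hQp i g hg
    letI : Module S Q := Module.compHom Q (algebraMap S A)
    haveI : IsScalarTower S A Q := IsScalarTower.of_algebraMap_smul fun _ _ => rfl
    have hQS : Module.Projective S Q := aux_trans S A Q
    let g' : P (i+1) →ₗ[S] Q := (g.restrictScalars S) ∘ₗ (TensorProduct.mk S A (P (i+1)) 1)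
    have hg' : g' ∘ₗ d (i+1) = 0 := by
      ext x
      have := LinearMap.congr_fun hg ((1:A) ⊗ₜ[S] x)
      simpa [g'] using this
    obtain ⟨h, hh⟩ := hQ (ModuleCat.of S Q) hQS i g' hg'
    refine ⟨(LinearMap.liftBaseChange A h : A ⊗[S] P i →ₗ[A] Q), ?_⟩
    apply TensorProduct.AlgebraTensorModule.curry_injective
    ext x
    have := LinearMap.congr_fun hh x
    simpa [g'] using this

theorem aux_surj {S A : Type u} [CommRing S] [CommRing A] [Algebra S A]
    (ι : A →ₗ[S] S) (hι : ∀ a, algebraMap S A (ι a) = a) : Module.Projective S A :=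
  Module.Projective.of_split ι (Algebra.linearMap S A) (by ext a; simp [hι])

/-- the back map `A ⊗ Q → Q`. -/
noncomputable def auxRho {S A : Type u} [CommRing S] [CommRing A] [Algebra S A]
    (ι : A →ₗ[S] S) (Q : Type u) [AddCommGroup Q] [Module S Q] :
    TensorProduct S A Q →ₗ[S] Q :=
  TensorProduct.lid S Q ∘ₗ LinearMap.rTensor Q ι

open scoped TensorProduct in
theorem auxRho_tmul {S A : Type u} [CommRing S] [CommRing A] [Algebra S A]
    (ι : A →ₗ[S] S) (Q : Type u) [AddCommGroup Q] [Module S Q] (a : A) (q : Q) :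
    auxRho ι Q (a ⊗ₜ[S] q) = ι a • q := by
  simp [auxRho]

open scoped TensorProduct in
theorem aux_restrict {S A : Type u} [CommRing S] [CommRing A] [Algebra S A]
    (ι : A →ₗ[S] S) (hι : ∀ a, algebraMap S A (ι a) = a)
    (N : Type u) [AddCommGroup N] [Module S N] [Module A N] [IsScalarTower S A N]
    (hN : IsSGProjective A N) : IsSGProjective S N := by
  have hA := aux_surj ι hι
  have hsurj : Function.Surjective (algebraMap S A) := fun a => ⟨ι a, hι a⟩
  obtain ⟨P, hP, f, hff, hker, ⟨e⟩, hQ⟩ := hN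
  letI : Module S P := Module.compHom P (algebraMap S A)
  haveI : IsScalarTower S A P := IsScalarTower.of_algebraMap_smul fun _ _ => rfl
  have hPS : Module.Projective S P := aux_trans S A P
  refine ⟨ModuleCat.of S P, hPS, f.restrictScalars S, ?_, ?_, ?_, ?_⟩
  · ext x
    exact LinearMap.congr_fun hff x
  · ext x
    have := SetLike.ext_iff.mp hker x
    simpa using this
  · exact ⟨e.restrictScalars S⟩
  · intro Q hQp g hg
    let g0 : P →ₗ[S] A ⊗[S] Q := TensorProduct.mk S A Q 1 ∘ₗ g
    let g' : P →ₗ[A] A ⊗[S] Q := LinearMap.extendScalarsOfSurjective hsurj g0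
    have hg' : g' ∘ₗ f = 0 := by
      ext x
      have : g (f x) = 0 := LinearMap.congr_fun hg x
      simp [g', g0, this]
    obtain ⟨h, hh⟩ := hQ (ModuleCat.of A (A ⊗[S] Q))
      (inferInstance : Module.Projective A (A ⊗[S] Q)) g' hg'
    refine ⟨auxRho ι Q ∘ₗ (h.restrictScalars S), ?_⟩
    ext x
    have h1 : (1:A) ⊗ₜ[S] g x = h (f x) := LinearMap.congr_fun hh x
    have h2 : auxRho ι Q ((1:A) ⊗ₜ[S] g x) = g x := by
      rw [auxRho_tmul, ← map_smul]
      congr 1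
      rw [← algebraMap_smul A (ι 1) (x : P), hι, one_smul]
    rw [h1] at h2
    exact h2.symm

theorem aux_prod {S : Type u} [CommRing S] (M N : Type u) [AddCommGroup M] [Module S M]
    [AddCommGroup N] [Module S N] (hM : IsSGProjective S M) (hN : IsSGProjective S N) :
    IsSGProjective S (M × N) := by
  obtain ⟨P, hP, f, hff, hker, ⟨e⟩, hQ⟩ := hM
  obtain ⟨P', hP', f', hff', hker', ⟨e'⟩, hQ'⟩ := hN
  refine ⟨ModuleCat.of S (P × P'), (inferInstance : Module.Projective S (P × P')),
    f.prodMap f', ?_, ?_, ?_, ?_⟩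
  · rw [LinearMap.prodMap_comp, hff, hff', LinearMap.prodMap_zero]
  · rw [LinearMap.ker_prodMap, LinearMap.range_prodMap, hker, hker']
  · let j : M →ₗ[S] P := (LinearMap.range f).subtype ∘ₗ e.toLinearMap
    let j' : N →ₗ[S] P' := (LinearMap.range f').subtype ∘ₗ e'.toLinearMap
    have hj : Function.Injective j := Subtype.val_injective.comp e.injective
    have hj' : Function.Injective j' := Subtype.val_injective.comp e'.injective
    have hjr : LinearMap.range j = LinearMap.range f := by simp [j, LinearMap.range_comp]
    have hjr' : LinearMap.range j' = LinearMap.range f' := by simp [j', LinearMap.range_comp]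
    have hJ : Function.Injective (j.prodMap j') := hj.prodMap hj'
    have hr : LinearMap.range (j.prodMap j') = LinearMap.range (f.prodMap f') := by
      rw [LinearMap.range_prodMap, LinearMap.range_prodMap, hjr, hjr']
    exact ⟨(LinearEquiv.ofInjective _ hJ).trans (LinearEquiv.ofEq _ _ hr)⟩
  · intro Q hQp g hg
    obtain ⟨h, hh⟩ := hQ Q hQp (g ∘ₗ LinearMap.inl S P P') (by
      ext x
      have := LinearMap.congr_fun hg (x, 0)
      simpa using this)
    obtain ⟨h', hh'⟩ := hQ' Q hQp (g ∘ₗ LinearMap.inr S P P') (by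
      ext x
      have := LinearMap.congr_fun hg (0, x)
      simpa using this)
    refine ⟨h.coprod h', ?_⟩
    apply LinearMap.prod_ext
    · rw [hh]; ext x; simp
    · rw [hh']; ext x; simp

theorem aux_equiv {S : Type u} [CommRing S] {M N : Type u} [AddCommGroup M] [Module S M]
    [AddCommGroup N] [Module S N] (φ : M ≃ₗ[S] N) (hN : IsSGProjective S N) :
    IsSGProjective S M := by
  obtain ⟨P, hP, f, hff, hker, ⟨e⟩, hQ⟩ := hN
  exact ⟨P, hP, f, hff, hker, ⟨φ.trans e⟩, hQ⟩

open scoped TensorProduct in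
theorem aux_main (S A B : Type u) [CommRing S] [CommRing A] [CommRing B] [Algebra S A]
    [Algebra S B] (ι : A →ₗ[S] S) (hι : ∀ a, algebraMap S A (ι a) = a)
    (κ : B →ₗ[S] S) (hκ : ∀ a, algebraMap S B (κ a) = a)
    (h1 : ι 1 + κ 1 = 1) (hικ : ∀ a, algebraMap S B (ι a) = 0)
    (hκι : ∀ a, algebraMap S A (κ a) = 0)
    (hA : ∀ M : ModuleCat.{u} A, IsGProjective A M → IsSGProjective A M)
    (hB : ∀ M : ModuleCat.{u} B, IsGProjective B M → IsSGProjective B M)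
    (M : Type u) [AddCommGroup M] [Module S M] (hM : IsGProjective S M) :
    IsSGProjective S M := by
  haveI := aux_surj ι hι
  haveI := aux_surj κ hκ
  have a1 := hA (ModuleCat.of A (A ⊗[S] M)) (aux_baseChange S A M hM)
  have a2 := hB (ModuleCat.of B (B ⊗[S] M)) (aux_baseChange S B M hM)
  have b1 : IsSGProjective S (A ⊗[S] M) := aux_restrict ι hι _ a1
  have b2 : IsSGProjective S (B ⊗[S] M) := aux_restrict κ hκ _ a2
  have key : ∀ (C : Type u) [CommRing C] [Algebra S C] (s : S) (m : M),
      s • ((1 : C) ⊗ₜ[S] m) = algebraMap S C s ⊗ₜ[S] m := by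
    intro C _ _ s m
    rw [TensorProduct.smul_tmul', Algebra.algebraMap_eq_smul_one]
  refine aux_equiv (LinearEquiv.ofLinearMap
    ((TensorProduct.mk S A M 1).prod (TensorProduct.mk S B M 1))
    ((auxRho ι M).coprod (auxRho κ M)) ?_ ?_) (aux_prod _ _ b1 b2)
  · apply LinearMap.prod_ext
    · apply TensorProduct.ext'
      intro a m
      simp [auxRho_tmul, key, hι, hικ]
    · apply TensorProduct.ext'
      intro a m
      simp [auxRho_tmul, key, hκ, hκι]
  · ext m
    simp [auxRho_tmul, ← add_smul, h1]

/-- If `R₁`, `R₂` have finite Gorenstein global dimension and every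
Gorenstein projective `Rᵢ`-module is strongly Gorenstein projective (`i = 1, 2`), then
every Gorenstein projective `R₁ × R₂`-module is strongly Gorenstein projective. -/
theorem stmt18 (R₁ R₂ : Type u) [CommRing R₁] [CommRing R₂]
    (hgl₁ : ∃ n : ℕ, ∀ M : ModuleCat.{u} R₁, GpdLE R₁ n M)
    (hgl₂ : ∃ n : ℕ, ∀ M : ModuleCat.{u} R₂, GpdLE R₂ n M)
    (h₁ : ∀ M : ModuleCat.{u} R₁, IsGProjective R₁ M → IsSGProjective R₁ M)
    (h₂ : ∀ M : ModuleCat.{u} R₂, IsGProjective R₂ M → IsSGProjective R₂ M) :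
    ∀ M : ModuleCat.{u} (R₁ × R₂), IsGProjective (R₁ × R₂) M →
      IsSGProjective (R₁ × R₂) M := by
  intro M hM
  letI : Algebra (R₁ × R₂) R₁ := (RingHom.fst R₁ R₂).toAlgebra
  letI : Algebra (R₁ × R₂) R₂ := (RingHom.snd R₁ R₂).toAlgebra
  let ι : R₁ →ₗ[R₁ × R₂] R₁ × R₂ :=
    { toFun := fun a => (a, 0)
      map_add' := fun a b => by simp
      map_smul' := fun s a => by
        change (s.1 * a, (0 : R₂)) = (s.1 * a, s.2 * 0)
        rw [mul_zero] }
  let κ : R₂ →ₗ[R₁ × R₂] R₁ × R₂ :=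
    { toFun := fun a => (0, a)
      map_add' := fun a b => by simp
      map_smul' := fun s a => by
        change ((0 : R₁), s.2 * a) = (s.1 * 0, s.2 * a)
        rw [mul_zero] }
  refine aux_main (R₁ × R₂) R₁ R₂ ι (fun _ => rfl) κ (fun _ => rfl) ?_ (fun _ => rfl)
    (fun _ => rfl) h₁ h₂ M hM
  change ((1 : R₁), (0 : R₂)) + ((0 : R₁), (1 : R₂)) = 1
  simp
end
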